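/- arXiv:0904.1421 — 10 statements merged into one kernel-verified Lean document; each statement's English description precedes it below -/
import Mathlib

section
/- Let n ∈ ℤ. The pairs (x̃, ȳ) ∈ ℤ[π₋] × π₋ with w₋(ȳ) = −1 satisfying (1 − ȳ)·x̃ = 1 − β̄^{2n} in ℤ[π₋] are exactly the pairs of the following form: ȳ = c̄_L^{ℓ} and x̃ = Σ_{j=0}^{2n/ℓ−1} c̄_L^{jℓ} (i.e. 1 + c̄_L^{ℓ} + c̄_L^{2ℓ} + ⋯ + c̄_L^{2n−ℓ}) if n/ℓ > 0, x̃ = 0 if n = 0, and x̃ = −Σ_{j=1}^{−2n/ℓ} c̄_L^{−jℓ} (i.e. −c̄_L^{−ℓ} − c̄_L^{−2ℓ} − ⋯ − c̄_L^{2n}) if n/ℓ < 0, where c̄_L := β̄ᾱ^{−L} = ᾱ^{L}β̄, L ranges over all integers, and ℓ ranges over the odd divisors of n when n ≠ 0 and over all odd integers when n = 0. (Lemma 5.2.) -/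
namespace Stmt9

/-- The free group of rank 2, `F₂ = ⟨α, β⟩`. -/
abbrev F2 : Type := FreeGroup (Fin 2)

/-- The generator `α`. -/
def fα : F2 := FreeGroup.of 0

/-- The generator `β`. -/
def fβ : F2 := FreeGroup.of 1

/-- The Klein bottle relator `B = αβαβ⁻¹`. -/
def B : F2 := fα * fβ * fα * fβ⁻¹

/-- The normal closure `N = ⟪αβαβ⁻¹⟫`. -/
abbrev N : Subgroup F2 := Subgroup.normalClosure {B}

/-- The Klein bottle group `π₋ = F₂/⟪αβαβ⁻¹⟫`. -/
abbrev K := F2 ⧸ N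

/-- The image `ᾱ` of `α` in `π₋`. -/
def pα : K := QuotientGroup.mk fα

/-- The image `β̄` of `β` in `π₋`. -/
def pβ : K := QuotientGroup.mk fβ

/-- The "geometric sum" `geom x m := ∑_{i=0}^{m-1} x^i` for `m ≥ 0` and
`geom x m := -∑_{i=m}^{-1} x^i` for `m < 0`, as an element of `ℤ[G]`. -/
noncomputable def geom {G : Type} [Group G] (x : G) (m : ℤ) : MonoidAlgebra ℤ G :=
  if 0 ≤ m then ∑ i ∈ Finset.range m.toNat, MonoidAlgebra.of ℤ G (x ^ (i : ℤ))
  else -∑ i ∈ Finset.range (-m).toNat, MonoidAlgebra.of ℤ G (x ^ (m + (i : ℤ)))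

/-- The alternating "geometric sum" `altGeom x m := ∑_{i=0}^{m-1} (-1)^i x^i` for `m ≥ 0`
and `altGeom x m := ∑_{j=1}^{-m} (-1)^{j+1} x^{-j}` for `m < 0`, as an element of `ℤ[G]`. -/
noncomputable def altGeom {G : Type} [Group G] (x : G) (m : ℤ) : MonoidAlgebra ℤ G :=
  if 0 ≤ m then
    ∑ i ∈ Finset.range m.toNat, ((-1 : ℤ) ^ i) • MonoidAlgebra.of ℤ G (x ^ (i : ℤ))
  else
    ∑ i ∈ Finset.range (-m).toNat, ((-1 : ℤ) ^ i) • MonoidAlgebra.of ℤ G (x ^ (-(i : ℤ) - 1))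

section GroupRing

variable {G : Type} [Group G]

theorem one_sub_mul_geom (x : G) (m : ℤ) :
    (1 - MonoidAlgebra.of ℤ G x) * geom x m = 1 - MonoidAlgebra.of ℤ G (x ^ m) := by
  unfold geom
  have telescope : ∀ (a : ℤ) (k : ℕ), (1 - MonoidAlgebra.of ℤ G x) *
      ∑ i ∈ Finset.range k, MonoidAlgebra.of ℤ G (x ^ (a + (i : ℤ))) =
        MonoidAlgebra.of ℤ G (x ^ a) - MonoidAlgebra.of ℤ G (x ^ (a + k)) := by
    intro a k
    induction k with
    | zero => simp
    | succ k ih =>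
      rw [Finset.sum_range_succ, mul_add, ih, sub_mul, one_mul, ← map_mul, ← zpow_one_add]
      have h : 1 + (a + (k : ℤ)) = a + ((k + 1 : ℕ) : ℤ) := by push_cast; ring
      rw [h]
      abel
  split_ifs with hm
  · have h := telescope 0 m.toNat
    simp only [zero_add, zpow_zero, map_one, Int.toNat_of_nonneg hm] at h
    exact h
  · have h := telescope m (-m).toNat
    rw [Int.toNat_of_nonneg (by omega), add_neg_cancel, zpow_zero, map_one] at h
    rw [mul_neg, h, neg_sub]

theorem eq_zero_of_one_sub_of_mul_eq_zero {y : G} (hy : Function.Injective fun k : ℤ => y ^ k)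
    {z : MonoidAlgebra ℤ G} (hz : (1 - MonoidAlgebra.of ℤ G y) * z = 0) : z = 0 := by
  have hfix : MonoidAlgebra.of ℤ G y * z = z := by
    rw [sub_mul, one_mul, sub_eq_zero] at hz
    exact hz.symm
  have hstep : ∀ g, z.coeff (y * g) = z.coeff g := by
    intro g
    conv_lhs => rw [← hfix]
    simp [MonoidAlgebra.of_apply]
  have hpow : ∀ (k : ℕ) g, z.coeff (y ^ k * g) = z.coeff g := by
    intro k g
    induction k with
    | zero => simp
    | succ k ih => rw [pow_succ', mul_assoc, hstep, ih]
  ext g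
  by_contra hg
  refine Set.infinite_of_injective_forall_mem (f := fun k : ℕ => y ^ k * g) ?_ ?_
    z.coeff.support.finite_toSet
  · intro a b hab
    have h : y ^ (a : ℤ) = y ^ (b : ℤ) := by
      simpa using hab
    exact_mod_cast hy h
  · intro k
    simpa [hpow] using hg

theorem map_eq_one_of_one_sub_of_mul_eq {H : Type} [Group H] (f : G →* H) {y g : G}
    (hy : f y = 1) {x : MonoidAlgebra ℤ G}
    (h : (1 - MonoidAlgebra.of ℤ G y) * x = 1 - MonoidAlgebra.of ℤ G g) : f g = 1 := by
  have h' := congrArg (MonoidAlgebra.lift ℤ (MonoidAlgebra ℤ H) G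
    ((MonoidAlgebra.of ℤ H).comp f)) h
  simp only [map_mul, map_sub, map_one, MonoidAlgebra.lift_of, MonoidHom.comp_apply, hy,
    sub_self, zero_mul] at h'
  apply MonoidAlgebra.of_injective (R := ℤ)
  rw [map_one]
  exact (sub_eq_zero.mp h'.symm).symm

end GroupRing

theorem semiconjBy_pβ_pα : SemiconjBy pβ pα pα⁻¹ := by
  have h : pα * pβ * pα * pβ⁻¹ = 1 :=
    (QuotientGroup.eq_one_iff B).mpr (Subgroup.subset_normalClosure rfl)
  rw [mul_inv_eq_one, mul_assoc] at h
  exact eq_inv_mul_of_mul_eq h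

theorem commute_pβ_zpow_of_even {s : ℤ} (hs : Even s) : Commute (pβ ^ s) pα := by
  obtain ⟨m, rfl⟩ := hs
  have h : SemiconjBy (pβ * pβ) pα pα := by
    simpa using semiconjBy_pβ_pα.inv_right.mul_left semiconjBy_pβ_pα
  rw [← two_mul, zpow_mul, zpow_two]
  exact Commute.zpow_left h m

theorem semiconjBy_pβ_zpow_of_odd {s : ℤ} (hs : Odd s) : SemiconjBy (pβ ^ s) pα pα⁻¹ := by
  obtain ⟨m, rfl⟩ := hs
  rw [zpow_add_one]
  exact SemiconjBy.mul_left (commute_pβ_zpow_of_even (even_two_mul m)).inv_right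
    semiconjBy_pβ_pα

theorem exists_eq_pα_zpow_mul_pβ_zpow (y : K) : ∃ r s : ℤ, y = pα ^ r * pβ ^ s := by
  induction y using QuotientGroup.induction_on with
  | H a =>
  induction a using FreeGroup.induction_on with
  | C1 => exact ⟨0, 0, by simp⟩
  | of i =>
    fin_cases i
    · exact ⟨1, 0, by simp [pα, fα]⟩
    · exact ⟨0, 1, by simp [pβ, fβ]⟩
  | inv_of i _ =>
    fin_cases i
    · exact ⟨-1, 0, by simp [pα, fα]⟩
    · exact ⟨0, -1, by simp [pβ, fβ]⟩
  | mul a b ha hb =>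
    obtain ⟨r, s, h⟩ := ha
    obtain ⟨r', s', h'⟩ := hb
    rw [QuotientGroup.mk_mul, h, h']
    rcases Int.even_or_odd s with hs | hs
    · refine ⟨r + r', s + s', ?_⟩
      rw [zpow_add, zpow_add, mul_assoc, ← mul_assoc (pβ ^ s),
        ((commute_pβ_zpow_of_even hs).zpow_right r').eq]
      group
    · refine ⟨r - r', s + s', ?_⟩
      rw [zpow_sub, zpow_add, mul_assoc, ← mul_assoc (pβ ^ s),
        ((semiconjBy_pβ_zpow_of_odd hs).zpow_right r').eq]
      group

theorem pα_zpow_mul_pβ_sq (L : ℤ) : (pα ^ L * pβ) ^ (2 : ℤ) = pβ ^ (2 : ℤ) := by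
  rw [zpow_two, zpow_two, mul_assoc, ← mul_assoc pβ, (semiconjBy_pβ_pα.zpow_right L).eq]
  group

theorem pα_zpow_mul_pβ_zpow_two_mul (L m : ℤ) :
    (pα ^ L * pβ) ^ (2 * m) = pβ ^ (2 * m) := by
  rw [zpow_mul, pα_zpow_mul_pβ_sq, ← zpow_mul]

theorem pα_zpow_mul_pβ_zpow_of_odd (L : ℤ) {s : ℤ} (hs : Odd s) :
    (pα ^ L * pβ) ^ s = pα ^ L * pβ ^ s := by
  obtain ⟨m, rfl⟩ := hs
  rw [zpow_add_one, pα_zpow_mul_pβ_zpow_two_mul, ← mul_assoc,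
    ((commute_pβ_zpow_of_even (even_two_mul m)).zpow_right L).eq, mul_assoc, zpow_add_one]

theorem exists_hom_pβ {A : Type} [CommGroup A] (a : A) :
    ∃ f : K →* A, f pα = 1 ∧ f pβ = a := by
  refine ⟨QuotientGroup.lift N (FreeGroup.lift ![1, a]) ?_, ?_, ?_⟩
  · intro x hx
    have h : N ≤ (FreeGroup.lift ![1, a]).ker := by
      apply Subgroup.normalClosure_le_normal
      rintro _ rfl
      simp [B, fα, fβ, MonoidHom.mem_ker]
    exact h hx
  · simp [pα, fα]
  · simp [pβ, fβ]

theorem zpow_injective_of_odd (L : ℤ) {s : ℤ} (hs : Odd s) :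
    Function.Injective fun k : ℤ => ((pα ^ L * pβ) ^ s) ^ k := by
  intro a b hab
  obtain ⟨f, hα, hβ⟩ := exists_hom_pβ (Multiplicative.ofAdd (1 : ℤ))
  have h := congrArg (fun x => Multiplicative.toAdd (f x)) hab
  have hs0 : s ≠ 0 := by
    rintro rfl
    simp at hs
  simpa [map_zpow, hα, hβ, hs0] using h

theorem dvd_of_one_sub_mul_eq {n r s : ℤ} (hs : Odd s) {x : MonoidAlgebra ℤ K}
    (h : (1 - MonoidAlgebra.of ℤ K (pα ^ r * pβ ^ s)) * x =
      1 - MonoidAlgebra.of ℤ K (pβ ^ (2 * n))) : s ∣ n := by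
  obtain ⟨f, hα, hβ⟩ := exists_hom_pβ (Multiplicative.ofAdd (1 : ZMod s.natAbs))
  have key : ∀ k : ℤ, f (pβ ^ k) = 1 ↔ s ∣ k := by
    intro k
    rw [map_zpow, hβ, ← ofAdd_zsmul, ofAdd_eq_one, zsmul_one, ZMod.intCast_zmod_eq_zero_iff_dvd,
      Int.natAbs_dvd]
  have h2 : s ∣ 2 * n := by
    rw [← key]
    refine map_eq_one_of_one_sub_of_mul_eq f ?_ h
    rw [map_mul, map_zpow, hα, one_zpow, one_mul]
    exact (key s).mpr dvd_rfl
  have hc : IsCoprime s 2 := by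
    obtain ⟨m, rfl⟩ := hs
    exact ⟨1, -m, by ring⟩
  exact hc.dvd_of_dvd_mul_left h2

/-- **Lemma 5.2.**
For `n ∈ ℤ`, the pairs `(x̃, ȳ) ∈ ℤ[π₋] × π₋` with `w₋(ȳ) = -1` satisfying
`(1 - ȳ)·x̃ = 1 - β̄^{2n}` are exactly those of the form `ȳ = (ᾱ^L β̄)^ℓ`,
`x̃ = geom ((ᾱ^L β̄)^ℓ) (2n/ℓ)`, where `L` ranges over all integers, and `ℓ` ranges over
the odd divisors of `n` when `n ≠ 0` and over all odd integers when `n = 0`. -/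
theorem statement (n : ℤ) (w : K →* ℤˣ) (hwα : w pα = 1) (hwβ : w pβ = -1)
    (xt : MonoidAlgebra ℤ K) (yb : K) :
    (w yb = -1 ∧
      (1 - MonoidAlgebra.of ℤ K yb) * xt = 1 - MonoidAlgebra.of ℤ K (pβ ^ (2 * n))) ↔
    (∃ L ℓ : ℤ, Odd ℓ ∧ (n ≠ 0 → ℓ ∣ n) ∧
      yb = (pα ^ L * pβ) ^ ℓ ∧ xt = geom ((pα ^ L * pβ) ^ ℓ) (2 * n / ℓ)) := by
  have solves : ∀ L ℓ : ℤ, ℓ ∣ n →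
      (1 - MonoidAlgebra.of ℤ K ((pα ^ L * pβ) ^ ℓ)) * geom ((pα ^ L * pβ) ^ ℓ) (2 * n / ℓ) =
        1 - MonoidAlgebra.of ℤ K (pβ ^ (2 * n)) := by
    intro L ℓ hdvd
    rw [one_sub_mul_geom, ← zpow_mul, Int.mul_ediv_cancel' (hdvd.mul_left 2),
      pα_zpow_mul_pβ_zpow_two_mul]
  constructor
  · rintro ⟨hw, h⟩
    obtain ⟨L, ℓ, rfl⟩ := exists_eq_pα_zpow_mul_pβ_zpow yb
    have hodd : Odd ℓ := by
      rw [← Int.not_even_iff_odd]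
      intro he
      rw [map_mul, map_zpow, map_zpow, hwα, hwβ, one_zpow, one_mul, he.neg_one_zpow] at hw
      exact absurd hw (by decide)
    have hdvd := dvd_of_one_sub_mul_eq hodd h
    rw [← pα_zpow_mul_pβ_zpow_of_odd L hodd] at h ⊢
    refine ⟨L, ℓ, hodd, fun _ => hdvd, rfl, sub_eq_zero.mp ?_⟩
    apply eq_zero_of_one_sub_of_mul_eq_zero (zpow_injective_of_odd L hodd)
    rw [mul_sub, h, solves L ℓ hdvd, sub_self]
  · rintro ⟨L, ℓ, hodd, hdvd, rfl, rfl⟩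
    refine ⟨?_, solves L ℓ ?_⟩
    · rw [map_zpow, map_mul, map_zpow, hwα, hwβ, one_zpow, one_mul, hodd.neg_one_zpow]
    · rcases eq_or_ne n 0 with rfl | hn
      · exact dvd_zero ℓ
      · exact hdvd hn

end Stmt9
end

section
/- Let m, n ∈ ℤ and consider the equation (1 + ȳ)·x̃ = 1 − ᾱ^{2m}β̄^{2n} in ℤ[π₊] with unknowns x̃ ∈ ℤ[π₊] and ȳ ∈ π₊. If (m,n) ≠ (0,0), set d := gcd(m,n) and c̄ := ᾱ^{m/d}β̄^{n/d}; then the solutions are exactly the pairs ȳ = c̄^{ℓ} with x̃ = Σ_{j=0}^{2d/ℓ−1} (−1)^j c̄^{jℓ} (i.e. 1 − c̄^{ℓ} + c̄^{2ℓ} − ⋯ + c̄^{2d−2ℓ} − c̄^{2d−ℓ}) when ℓ > 0, and x̃ = Σ_{j=1}^{−2d/ℓ} (−1)^{j+1} c̄^{−jℓ} (i.e. c̄^{−ℓ} − c̄^{−2ℓ} + ⋯ + c̄^{2d+ℓ} − c̄^{2d}) when ℓ < 0, where ℓ ranges over all nonzero divisors of d. If m = n = 0, the solutions are exactly the pairs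 with x̃ = 0 and ȳ ∈ π₊ arbitrary. (Lemma 5.4.) -/
namespace Stmt10

/-- The free group of rank 2, `F₂ = ⟨α, β⟩`. -/
abbrev F2 : Type := FreeGroup (Fin 2)

/-- The generator `α`. -/
def fα : F2 := FreeGroup.of 0

/-- The generator `β`. -/
def fβ : F2 := FreeGroup.of 1

/-- The torus relator `B = αβα⁻¹β⁻¹`. -/
def B : F2 := fα * fβ * fα⁻¹ * fβ⁻¹

/-- The normal closure `N = ⟪αβα⁻¹β⁻¹⟫`. -/
abbrev N : Subgroup F2 := Subgroup.normalClosure {B}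

/-- The free abelian group of rank 2, `π₊ = F₂/⟪αβα⁻¹β⁻¹⟫`, written multiplicatively. -/
abbrev K := F2 ⧸ N

/-- The image `ᾱ` of `α` in `π₊`. -/
def pα : K := QuotientGroup.mk fα

/-- The image `β̄` of `β` in `π₊`. -/
def pβ : K := QuotientGroup.mk fβ

/-- The "geometric sum" `geom x m := ∑_{i=0}^{m-1} x^i` for `m ≥ 0` and
`geom x m := -∑_{i=m}^{-1} x^i` for `m < 0`, as an element of `ℤ[G]`. -/
noncomputable def geom {G : Type} [Group G] (x : G) (m : ℤ) : MonoidAlgebra ℤ G :=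
  if 0 ≤ m then ∑ i ∈ Finset.range m.toNat, MonoidAlgebra.of ℤ G (x ^ (i : ℤ))
  else -∑ i ∈ Finset.range (-m).toNat, MonoidAlgebra.of ℤ G (x ^ (m + (i : ℤ)))

/-- The alternating "geometric sum" `altGeom x m := ∑_{i=0}^{m-1} (-1)^i x^i` for `m ≥ 0`
and `altGeom x m := ∑_{j=1}^{-m} (-1)^{j+1} x^{-j}` for `m < 0`, as an element of `ℤ[G]`. -/
noncomputable def altGeom {G : Type} [Group G] (x : G) (m : ℤ) : MonoidAlgebra ℤ G :=
  if 0 ≤ m then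
    ∑ i ∈ Finset.range m.toNat, ((-1 : ℤ) ^ i) • MonoidAlgebra.of ℤ G (x ^ (i : ℤ))
  else
    ∑ i ∈ Finset.range (-m).toNat, ((-1 : ℤ) ^ i) • MonoidAlgebra.of ℤ G (x ^ (-(i : ℤ) - 1))

section GroupRing

open MonoidAlgebra

variable {G : Type}

theorem eq_one_of_one_add_of_mul_eq_of_sq_eq_one [CommGroup G] {y g : G} {x : MonoidAlgebra ℤ G}
    (hy : y ^ 2 = 1) (hy1 : y ≠ 1) (h : (1 + of ℤ G y) * x = 1 - of ℤ G g) : g = 1 := by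
  classical
  by_contra hg
  have hsq : of ℤ G y * of ℤ G y = 1 := by rw [← map_mul, ← sq, hy, map_one]
  have h0 : (1 - of ℤ G y) * (1 - of ℤ G g) = 0 := by
    rw [← h]
    linear_combination (-x) * hsq
  have h1 : (1 : MonoidAlgebra ℤ G) - of ℤ G y - of ℤ G g + of ℤ G (y * g) = 0 := by
    rw [map_mul, ← h0]
    ring
  have h2 := congrArg (fun z => z.coeff 1) h1
  simp only [of_apply, one_def, coeff_add, coeff_sub, coeff_single, coeff_zero,
    Finsupp.add_apply, Finsupp.sub_apply, Finsupp.single_apply, Finsupp.zero_apply, if_neg hy1,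
    if_neg hg] at h2
  split_ifs at h2 <;> simp_all

theorem mem_zpowers_sq_of_one_add_of_mul_eq [CommGroup G] [IsMulTorsionFree G] {y g : G}
    {x : MonoidAlgebra ℤ G} (hg : g ≠ 1) (h : (1 + of ℤ G y) * x = 1 - of ℤ G g) :
    g ∈ Subgroup.zpowers (y ^ 2) := by
  by_cases hy : y ∈ Subgroup.zpowers (y ^ 2)
  · exfalso
    obtain ⟨k, hk⟩ := Subgroup.mem_zpowers_iff.mp hy
    have hy1 : y = 1 := by
      have hpow : y ^ (2 * k - 1) = 1 := by
        rw [zpow_sub, zpow_mul, zpow_one]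
        norm_cast at hk ⊢
        rw [hk, mul_inv_cancel]
      exact (IsMulTorsionFree.zpow_eq_one_iff_left (by omega)).mp hpow
    subst hy1
    classical
    rw [map_one, add_mul, one_mul] at h
    have h2 := congrArg (fun z => z.coeff 1) h
    simp [one_def, coeff_single, hg] at h2
    omega
  · let q : G →* G ⧸ Subgroup.zpowers (y ^ 2) := QuotientGroup.mk' (Subgroup.zpowers (y ^ 2))
    have hq := congrArg (mapDomainRingHom ℤ q) h
    simp only [map_mul, map_add, map_sub, map_one, of_apply, mapDomainRingHom_apply,
      mapDomain_single] at hq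
    have hsq : (q y) ^ 2 = 1 := by
      rw [← map_pow]
      exact (QuotientGroup.eq_one_iff _).mpr (Subgroup.mem_zpowers _)
    have hq1 : q y ≠ 1 := fun h' => hy ((QuotientGroup.eq_one_iff _).mp h')
    exact (QuotientGroup.eq_one_iff _).mp
      (eq_one_of_one_add_of_mul_eq_of_sq_eq_one (g := q g) hsq hq1 hq)

theorem one_add_of_ne_zero [Group G] (y : G) : 1 + of ℤ G y ≠ 0 := fun h => by
  have h2 := congrArg (lift ℤ ℤ G 1) h
  rw [map_add, lift_of, map_one, map_zero] at h2
  simp at h2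

theorem one_add_of_mul_altGeom [Group G] (x : G) {m : ℤ} (hm : Even m) :
    (1 + of ℤ G x) * altGeom x m = 1 - of ℤ G (x ^ m) := by
  have key (z : G) (k : ℕ) :
      (1 + of ℤ G z) * ∑ i ∈ Finset.range k, ((-1 : ℤ) ^ i) • of ℤ G (z ^ (i : ℤ)) =
        1 - (-1 : ℤ) ^ k • of ℤ G (z ^ (k : ℤ)) := by
    induction k with
    | zero => simp [one_def]
    | succ k ih =>
      rw [Finset.sum_range_succ, mul_add, ih, mul_smul_comm, add_mul, one_mul, ← map_mul,
        ← zpow_one_add, smul_add, pow_succ, mul_neg_one, neg_smul, Nat.cast_succ, add_comm 1 (k : ℤ)]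
      abel
  unfold altGeom
  split_ifs with h
  · lift m to ℕ using h
    have hm' : Even m := by exact_mod_cast hm
    rw [Int.toNat_natCast, key, hm'.neg_one_pow, one_smul]
  · obtain ⟨k, rfl⟩ : ∃ k : ℕ, m = -k := ⟨(-m).toNat, by omega⟩
    have hk : Even k := by simpa using hm
    have hinv (i : ℕ) : of ℤ G (x ^ (-(i : ℤ) - 1)) = of ℤ G x⁻¹ * of ℤ G (x⁻¹ ^ (i : ℤ)) := by
      rw [← map_mul, ← zpow_one_add, inv_zpow', neg_add, neg_add_eq_sub, sub_eq_add_neg,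
        add_comm (-(i : ℤ)), neg_add_eq_sub, sub_eq_add_neg, add_comm]
    have hfac : (1 + of ℤ G x) * of ℤ G x⁻¹ = 1 + of ℤ G x⁻¹ := by
      rw [add_mul, ← map_mul, mul_inv_cancel, map_one, one_mul, add_comm]
    simp_rw [neg_neg, Int.toNat_natCast, hinv, ← mul_smul_comm]
    rw [← Finset.mul_sum, ← mul_assoc, hfac, key, hk.neg_one_pow, one_smul, inv_zpow']

end GroupRing

theorem commute_pα_pβ : Commute pα pβ := by
  have h : ((B : F2) : K) = 1 :=
    (QuotientGroup.eq_one_iff _).mpr (Subgroup.subset_normalClosure rfl)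
  have h' : pα * pβ * pα⁻¹ * pβ⁻¹ = 1 := h
  rwa [mul_inv_eq_one, mul_inv_eq_iff_eq_mul] at h'

theorem exists_eq_zpow_mul_zpow (k : K) : ∃ a b : ℤ, k = pα ^ a * pβ ^ b := by
  obtain ⟨w, rfl⟩ := QuotientGroup.mk_surjective k
  have hmul {k l : K} (hk : ∃ a b : ℤ, k = pα ^ a * pβ ^ b) (hl : ∃ a b : ℤ, l = pα ^ a * pβ ^ b) :
      ∃ a b : ℤ, k * l = pα ^ a * pβ ^ b := by
    obtain ⟨a, b, rfl⟩ := hk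
    obtain ⟨c, d, rfl⟩ := hl
    refine ⟨a + c, b + d, ?_⟩
    rw [zpow_add, zpow_add, mul_assoc, mul_assoc, ← mul_assoc (pβ ^ b), ← mul_assoc (pα ^ c),
      (commute_pα_pβ.zpow_zpow c b).eq]
  induction w using FreeGroup.induction_on with
  | C1 => exact ⟨0, 0, by simp⟩
  | of i =>
    fin_cases i
    · exact ⟨1, 0, by simp [pα, fα]⟩
    · exact ⟨0, 1, by simp [pβ, fβ]⟩
  | inv_of i _ =>
    fin_cases i
    · exact ⟨-1, 0, by simp [pα, fα]⟩
    · exact ⟨0, -1, by simp [pβ, fβ]⟩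
  | mul v w hv hw => exact hmul hv hw

/-- The exponents of `ᾱ` and `β̄`, as a homomorphism `π₊ → ℤ²`. -/
def exponents : K →* Multiplicative (ℤ × ℤ) :=
  QuotientGroup.lift N
    (FreeGroup.lift ![Multiplicative.ofAdd ((1, 0) : ℤ × ℤ), Multiplicative.ofAdd ((0, 1) : ℤ × ℤ)])
    (Subgroup.normalClosure_le_normal (by
      rintro _ rfl
      simp [B, fα, fβ, MonoidHom.mem_ker, mul_comm]))

theorem exponents_zpow_mul_zpow (a b : ℤ) :
    exponents (pα ^ a * pβ ^ b) = Multiplicative.ofAdd (a, b) := by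
  have hα : exponents pα = Multiplicative.ofAdd (1, 0) := by
    simp [exponents, pα, fα]
  have hβ : exponents pβ = Multiplicative.ofAdd (0, 1) := by
    simp [exponents, pβ, fβ]
  rw [map_mul, map_zpow, map_zpow, hα, hβ, ← ofAdd_zsmul, ← ofAdd_zsmul, ← ofAdd_add]
  simp

theorem exponents_injective : Function.Injective exponents := by
  refine (injective_iff_map_eq_one _).mpr fun k hk => ?_
  obtain ⟨a, b, rfl⟩ := exists_eq_zpow_mul_zpow k
  rw [exponents_zpow_mul_zpow, ofAdd_eq_one, Prod.mk_eq_zero] at hk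
  rw [hk.1, hk.2, zpow_zero, zpow_zero, mul_one]

theorem zpow_mul_zpow_inj {a b c d : ℤ} :
    pα ^ a * pβ ^ b = pα ^ c * pβ ^ d ↔ a = c ∧ b = d := by
  rw [← exponents_injective.eq_iff, exponents_zpow_mul_zpow, exponents_zpow_mul_zpow,
    Multiplicative.ofAdd.injective.eq_iff, Prod.mk.injEq]

theorem zpow_mul_zpow_zpow (a b k : ℤ) :
    (pα ^ a * pβ ^ b) ^ k = pα ^ (a * k) * pβ ^ (b * k) := by
  rw [(commute_pα_pβ.zpow_zpow a b).mul_zpow, zpow_mul, zpow_mul]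

theorem noZeroDivisors_groupRing : NoZeroDivisors (MonoidAlgebra ℤ K) :=
  have : UniqueProds K :=
    .of_injective_mulHom (exponents : K →ₙ* Multiplicative (ℤ × ℤ)) exponents_injective inferInstance
  inferInstance

theorem exists_sq_zpow_eq {y g : K} {x : MonoidAlgebra ℤ K} (hg : g ≠ 1)
    (h : (1 + MonoidAlgebra.of ℤ K y) * x = 1 - MonoidAlgebra.of ℤ K g) :
    ∃ s : ℤ, (y ^ 2) ^ s = g := by
  let _ : CommGroup K :=
    { (inferInstance : Group K) with
      mul_comm := fun a b => exponents_injective (by rw [map_mul, map_mul, mul_comm]) }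
  have : IsMulTorsionFree K := exponents_injective.isMulTorsionFree exponents
  exact Subgroup.mem_zpowers_iff.mp (mem_zpowers_sq_of_one_add_of_mul_eq hg h)

/-- **Lemma 5.4.**
Let `m, n ∈ ℤ` and consider `(1 + ȳ)·x̃ = 1 - ᾱ^{2m}β̄^{2n}` in `ℤ[π₊]`, with unknowns
`x̃ ∈ ℤ[π₊]` and `ȳ ∈ π₊`.  If `(m,n) ≠ (0,0)` then, with `d = gcd(m,n)` and
`c̄ = ᾱ^{m/d}β̄^{n/d}`, the solutions are exactly the pairs `ȳ = c̄^ℓ`,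
`x̃ = altGeom (c̄^ℓ) (2d/ℓ)` (i.e. `1 - c̄^ℓ + c̄^{2ℓ} - ⋯ - c̄^{2d-ℓ}` when `ℓ > 0` and
`c̄^{-ℓ} - c̄^{-2ℓ} + ⋯ - c̄^{2d}` when `ℓ < 0`), where `ℓ` ranges over all nonzero
divisors of `d`.  If `m = n = 0`, the solutions are exactly the pairs with `x̃ = 0`
and `ȳ ∈ π₊` arbitrary. -/
theorem statement (m n : ℤ) (xt : MonoidAlgebra ℤ K) (yb : K) :
    (¬(m = 0 ∧ n = 0) →
      (((1 + MonoidAlgebra.of ℤ K yb) * xt =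
          1 - MonoidAlgebra.of ℤ K (pα ^ (2 * m) * pβ ^ (2 * n))) ↔
        (∃ ℓ : ℤ, ℓ ≠ 0 ∧ ℓ ∣ (Int.gcd m n : ℤ) ∧
          yb = (pα ^ (m / (Int.gcd m n : ℤ)) * pβ ^ (n / (Int.gcd m n : ℤ))) ^ ℓ ∧
          xt = altGeom
            ((pα ^ (m / (Int.gcd m n : ℤ)) * pβ ^ (n / (Int.gcd m n : ℤ))) ^ ℓ)
            (2 * (Int.gcd m n : ℤ) / ℓ)))) ∧
    ((m = 0 ∧ n = 0) →
      (((1 + MonoidAlgebra.of ℤ K yb) * xt =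
          1 - MonoidAlgebra.of ℤ K (pα ^ (2 * m) * pβ ^ (2 * n))) ↔
        xt = 0)) := by
  have hnzd := noZeroDivisors_groupRing
  refine ⟨fun hmn => ?_, ?_⟩
  · have hd : (Int.gcd m n : ℤ) ≠ 0 := by
      rw [Ne, Nat.cast_eq_zero, Int.gcd_eq_zero_iff]
      exact hmn
    have hsol {ℓ : ℤ} (hℓ : ℓ ∣ (Int.gcd m n : ℤ)) :
        (1 + MonoidAlgebra.of ℤ K
            ((pα ^ (m / (Int.gcd m n : ℤ)) * pβ ^ (n / (Int.gcd m n : ℤ))) ^ ℓ)) *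
          altGeom ((pα ^ (m / (Int.gcd m n : ℤ)) * pβ ^ (n / (Int.gcd m n : ℤ))) ^ ℓ)
            (2 * (Int.gcd m n : ℤ) / ℓ) =
          1 - MonoidAlgebra.of ℤ K (pα ^ (2 * m) * pβ ^ (2 * n)) := by
      rw [one_add_of_mul_altGeom _ (by
        rw [Int.mul_ediv_assoc _ hℓ]
        exact even_two_mul _), ← zpow_mul, Int.mul_ediv_cancel' (hℓ.mul_left 2),
        zpow_mul_zpow_zpow, mul_left_comm, mul_left_comm (n / _),
        Int.ediv_mul_cancel (Int.gcd_dvd_left ..), Int.ediv_mul_cancel (Int.gcd_dvd_right ..)]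
    constructor
    · intro h
      have hg : pα ^ (2 * m) * pβ ^ (2 * n) ≠ 1 := fun hg => hmn <| by
        have h0 : pα ^ (2 * m) * pβ ^ (2 * n) = pα ^ (0 : ℤ) * pβ ^ (0 : ℤ) := by simpa using hg
        have := zpow_mul_zpow_inj.mp h0
        omega
      obtain ⟨s, hs⟩ := exists_sq_zpow_eq hg h
      obtain ⟨a, b, rfl⟩ := exists_eq_zpow_mul_zpow yb
      rw [← zpow_natCast, zpow_mul_zpow_zpow, zpow_mul_zpow_zpow, zpow_mul_zpow_inj] at hs
      have hm : m = s * a := by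
        have := hs.1
        push_cast at this
        linarith
      have hn : n = s * b := by
        have := hs.2
        push_cast at this
        linarith
      obtain ⟨ℓ, hℓ⟩ : s ∣ (Int.gcd m n : ℤ) :=
        Int.dvd_coe_gcd (Dvd.intro _ hm.symm) (Dvd.intro _ hn.symm)
      have hs0 : s ≠ 0 := by
        rintro rfl
        simp [hℓ] at hd
      have hexp {t c : ℤ} (ht : t = s * c) (hdt : (Int.gcd m n : ℤ) ∣ t) :
          c = t / (Int.gcd m n : ℤ) * ℓ := by
        apply mul_left_cancel₀ hs0
        rw [mul_left_comm, ← hℓ, Int.ediv_mul_cancel hdt, ht]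
      have hℓd : ℓ ∣ (Int.gcd m n : ℤ) := Dvd.intro_left _ hℓ.symm
      have hy : pα ^ a * pβ ^ b =
          (pα ^ (m / (Int.gcd m n : ℤ)) * pβ ^ (n / (Int.gcd m n : ℤ))) ^ ℓ := by
        rw [zpow_mul_zpow_zpow, ← hexp hm (Int.gcd_dvd_left ..), ← hexp hn (Int.gcd_dvd_right ..)]
      refine ⟨ℓ, fun h0 => hd (by rw [hℓ, h0, mul_zero]), hℓd, hy, ?_⟩
      rw [hy] at h
      exact mul_left_cancel₀ (one_add_of_ne_zero _) (h.trans (hsol hℓd).symm)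
    · rintro ⟨ℓ, -, hℓ, rfl, rfl⟩
      exact hsol hℓ
  · rintro ⟨rfl, rfl⟩
    simp only [mul_zero, zpow_zero, mul_one, map_one, sub_self, mul_eq_zero,
      one_add_of_ne_zero, false_or]

end Stmt10
end

section
/- Let n ∈ ℤ. The pairs (x̃, ȳ) ∈ ℤ[π₋] × π₋ with w₋(ȳ) = −1 satisfying (1 + ȳ)·x̃ = 1 − β̄^{2n} in ℤ[π₋] are exactly the pairs of the following form: ȳ = c̄_L^{ℓ} and x̃ = Σ_{j=0}^{2n/ℓ−1} (−1)^j c̄_L^{jℓ} (i.e. 1 − c̄_L^{ℓ} + c̄_L^{2ℓ} − ⋯ + c̄_L^{2n−2ℓ} − c̄_L^{2n−ℓ}) if n/ℓ > 0, x̃ = 0 if n = 0, and x̃ = Σ_{j=1}^{−2n/ℓ} (−1)^{j+1} c̄_L^{−jℓ} (i.e. c̄_L^{−ℓ} − c̄_L^{−2ℓ} + ⋯ + c̄_L^{2n+ℓ} − c̄_L^{2n}) if n/ℓ < 0, where c̄_L := β̄ᾱ^{−L} = ᾱ^{L}β̄, L ranges over all integers, and ℓ ranges over the odd divisors of n when n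 ≠ 0 and over all odd integers when n = 0. (Lemma 5.6.) -/
namespace Stmt11

/-- The free group of rank 2, `F₂ = ⟨α, β⟩`. -/
abbrev F2 : Type := FreeGroup (Fin 2)

/-- The generator `α`. -/
def fα : F2 := FreeGroup.of 0

/-- The generator `β`. -/
def fβ : F2 := FreeGroup.of 1

/-- The Klein bottle relator `B = αβαβ⁻¹`. -/
def B : F2 := fα * fβ * fα * fβ⁻¹

/-- The normal closure `N = ⟪αβαβ⁻¹⟫`. -/
abbrev N : Subgroup F2 := Subgroup.normalClosure {B}

/-- The Klein bottle group `π₋ = F₂/⟪αβαβ⁻¹⟫`. -/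
abbrev K := F2 ⧸ N

/-- The image `ᾱ` of `α` in `π₋`. -/
def pα : K := QuotientGroup.mk fα

/-- The image `β̄` of `β` in `π₋`. -/
def pβ : K := QuotientGroup.mk fβ

/-- The "geometric sum" `geom x m := ∑_{i=0}^{m-1} x^i` for `m ≥ 0` and
`geom x m := -∑_{i=m}^{-1} x^i` for `m < 0`, as an element of `ℤ[G]`. -/
noncomputable def geom {G : Type} [Group G] (x : G) (m : ℤ) : MonoidAlgebra ℤ G :=
  if 0 ≤ m then ∑ i ∈ Finset.range m.toNat, MonoidAlgebra.of ℤ G (x ^ (i : ℤ))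
  else -∑ i ∈ Finset.range (-m).toNat, MonoidAlgebra.of ℤ G (x ^ (m + (i : ℤ)))

/-- The alternating "geometric sum" `altGeom x m := ∑_{i=0}^{m-1} (-1)^i x^i` for `m ≥ 0`
and `altGeom x m := ∑_{j=1}^{-m} (-1)^{j+1} x^{-j}` for `m < 0`, as an element of `ℤ[G]`. -/
noncomputable def altGeom {G : Type} [Group G] (x : G) (m : ℤ) : MonoidAlgebra ℤ G :=
  if 0 ≤ m then
    ∑ i ∈ Finset.range m.toNat, ((-1 : ℤ) ^ i) • MonoidAlgebra.of ℤ G (x ^ (i : ℤ))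
  else
    ∑ i ∈ Finset.range (-m).toNat, ((-1 : ℤ) ^ i) • MonoidAlgebra.of ℤ G (x ^ (-(i : ℤ) - 1))

theorem one_add_of_mul_altGeom {G : Type} [Group G] (y : G) (m : ℤ) (hm : Even m) :
    (1 + MonoidAlgebra.of ℤ G y) * altGeom y m = 1 - MonoidAlgebra.of ℤ G (y ^ m) := by
  have tele (z : G) (k : ℕ) :
      (1 + MonoidAlgebra.of ℤ G z) *
          ∑ i ∈ Finset.range k, ((-1 : ℤ) ^ i) • MonoidAlgebra.of ℤ G (z ^ (i : ℤ)) =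
        1 - ((-1 : ℤ) ^ k) • MonoidAlgebra.of ℤ G (z ^ (k : ℤ)) := by
    induction k with
    | zero => simp [MonoidAlgebra.one_def]
    | succ k ih =>
      have hz : MonoidAlgebra.of ℤ G z * MonoidAlgebra.of ℤ G (z ^ (k : ℤ)) =
          MonoidAlgebra.of ℤ G (z ^ ((k + 1 : ℕ) : ℤ)) := by
        rw [← map_mul, ← zpow_one_add, add_comm]
        norm_cast
      rw [Finset.sum_range_succ, mul_add, ih, mul_smul_comm, add_mul, one_mul, hz, pow_succ,
        smul_add]
      simp only [mul_neg, mul_one, neg_smul]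
      abel
  unfold altGeom
  split_ifs with h
  · rw [tele, Int.toNat_of_nonneg h]
    have : Even m.toNat := by
      rw [← Int.even_coe_nat, Int.toNat_of_nonneg h]
      exact hm
    rw [this.neg_one_pow, one_smul]
  · have hM : ((-m).toNat : ℤ) = -m := Int.toNat_of_nonneg (by omega)
    have hE : Even (-m).toNat := by
      rw [← Int.even_coe_nat, hM]
      exact hm.neg
    have hshift (i : ℕ) : MonoidAlgebra.of ℤ G (y ^ (-(i : ℤ) - 1)) =
        MonoidAlgebra.of ℤ G y⁻¹ * MonoidAlgebra.of ℤ G (y⁻¹ ^ (i : ℤ)) := by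
      rw [← map_mul, ← zpow_one_add, inv_zpow']
      congr 2
      ring
    have hy : (1 + MonoidAlgebra.of ℤ G y) * MonoidAlgebra.of ℤ G y⁻¹ =
        1 + MonoidAlgebra.of ℤ G y⁻¹ := by
      rw [add_mul, one_mul, ← map_mul, mul_inv_cancel, map_one, add_comm]
    simp only [hshift, ← mul_smul_comm]
    rw [← Finset.mul_sum, ← mul_assoc, hy, tele, hE.neg_one_pow, one_smul, hM, inv_zpow', neg_neg]

theorem eq_zero_of_one_add_of_mul {G : Type} [Group G] {y : G}
    (hy : Function.Injective fun k : ℕ => y ^ k) {z : MonoidAlgebra ℤ G}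
    (hz : (1 + MonoidAlgebra.of ℤ G y) * z = 0) : z = 0 := by
  by_contra hne
  obtain ⟨g, hg⟩ : ∃ g, z.coeff g ≠ 0 :=
    Finsupp.ne_iff.1 (mt MonoidAlgebra.coeff_eq_zero.1 hne)
  have step (h : G) : z.coeff (y * h) = -z.coeff h := by
    have := congrArg (fun f : MonoidAlgebra ℤ G => f.coeff (y * h)) hz
    simp only [add_mul, one_mul, MonoidAlgebra.of_apply] at this
    have h2 : z.coeff (y * h) + (MonoidAlgebra.single y 1 * z).coeff (y * h) = 0 := this
    rw [MonoidAlgebra.coeff_single_mul_mul, one_mul] at h2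
    omega
  have all (k : ℕ) : z.coeff (y ^ k * g) ≠ 0 := by
    induction k with
    | zero => simpa using hg
    | succ k ih => rwa [pow_succ', mul_assoc, step, neg_ne_zero]
  refine Set.infinite_of_injective_forall_mem (s := {x | z.coeff x ≠ 0})
    (f := fun k : ℕ => y ^ k * g)
    (fun a b hab => hy (mul_right_cancel hab)) all ?_
  exact Finsupp.hasFiniteSupport z.coeff

theorem semiconjBy_pβ_pα : SemiconjBy pβ pα pα⁻¹ := by
  have h : pα * pβ * pα * pβ⁻¹ = 1 :=
    (QuotientGroup.eq_one_iff B).2 (Subgroup.subset_normalClosure rfl)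
  have h' : pα * (pβ * pα) = pβ := by
    rw [← mul_assoc]
    exact mul_inv_eq_one.1 h
  exact eq_inv_mul_of_mul_eq h'

theorem pα_zpow_mul_pβ_mul_pα_zpow (r : ℤ) : pα ^ r * pβ * pα ^ r = pβ := by
  rw [mul_assoc, (semiconjBy_pβ_pα.zpow_right r).eq, inv_zpow, mul_inv_cancel_left]

theorem commute_pβ_sq_pα_zpow (k r : ℤ) : Commute (pβ ^ (2 * k)) (pα ^ r) := by
  have h : Commute (pβ ^ 2) pα := by
    have := (semiconjBy_pβ_pα.inv_right).mul_left semiconjBy_pβ_pα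
    rwa [inv_inv, ← sq] at this
  rw [zpow_mul]
  exact (h.zpow_right r).zpow_left k

theorem pα_zpow_mul_pβ_zpow_two_mul (L k : ℤ) : (pα ^ L * pβ) ^ (2 * k) = pβ ^ (2 * k) := by
  rw [zpow_mul, zpow_mul]
  congr 1
  change (pα ^ L * pβ) ^ ((2 : ℕ) : ℤ) = pβ ^ ((2 : ℕ) : ℤ)
  rw [zpow_natCast, zpow_natCast, sq, sq, ← mul_assoc, pα_zpow_mul_pβ_mul_pα_zpow]

theorem pα_zpow_mul_pβ_zpow_of_odd (L : ℤ) {s : ℤ} (hs : Odd s) :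
    (pα ^ L * pβ) ^ s = pα ^ L * pβ ^ s := by
  obtain ⟨k, rfl⟩ := hs
  rw [zpow_add_one, pα_zpow_mul_pβ_zpow_two_mul, ← mul_assoc, (commute_pβ_sq_pα_zpow k L).eq,
    mul_assoc, ← zpow_add_one]

theorem exists_pβ_zpow_mul_pα_zpow (s r : ℤ) : ∃ r' : ℤ, pβ ^ s * pα ^ r = pα ^ r' * pβ ^ s := by
  obtain ⟨k, rfl | rfl⟩ := Int.even_or_odd' s
  · exact ⟨r, (commute_pβ_sq_pα_zpow k r).eq⟩
  · refine ⟨-r, ?_⟩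
    rw [zpow_add_one, mul_assoc, (semiconjBy_pβ_pα.zpow_right r).eq, inv_zpow', ← mul_assoc,
      (commute_pβ_sq_pα_zpow k (-r)).eq, mul_assoc]

theorem exists_eq_pα_zpow_mul_pβ_zpow (y : K) : ∃ r s : ℤ, y = pα ^ r * pβ ^ s := by
  obtain ⟨f, rfl⟩ := QuotientGroup.mk_surjective y
  have hgen (i : Fin 2) (e : ℤ) : ∃ r s : ℤ,
      ((FreeGroup.of i : F2) : K) ^ e = pα ^ r * pβ ^ s := by
    fin_cases i
    · exact ⟨e, 0, by simp [pα, fα]⟩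
    · exact ⟨0, e, by simp [pβ, fβ]⟩
  induction f using FreeGroup.induction_on with
  | C1 => exact ⟨0, 0, by simp⟩
  | of i => simpa using hgen i 1
  | inv_of i _ => simpa using hgen i (-1)
  | mul a b ha hb =>
    obtain ⟨r, s, h⟩ := ha
    obtain ⟨r', s', h'⟩ := hb
    obtain ⟨r'', h''⟩ := exists_pβ_zpow_mul_pα_zpow s r'
    refine ⟨r + r'', s + s', ?_⟩
    rw [QuotientGroup.mk_mul, h, h', mul_assoc, ← mul_assoc (pβ ^ s), h'', zpow_add, zpow_add]
    simp only [mul_assoc]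

theorem exists_monoidHom_pα_pβ {A : Type*} [CommGroup A] (a : A) :
    ∃ φ : K →* A, φ pα = 1 ∧ φ pβ = a := by
  let f : F2 →* A := FreeGroup.lift ![1, a]
  have hα : f fα = 1 := by simp [f, fα]
  have hβ : f fβ = a := by simp [f, fβ]
  have hN : N ≤ f.ker := Subgroup.normalClosure_le_normal (by
    rintro _ rfl
    simp [MonoidHom.mem_ker, B, hα, hβ])
  exact ⟨QuotientGroup.lift N f hN, hα, hβ⟩

theorem injective_pow_of_odd (L : ℤ) {s : ℤ} (hs : Odd s) :
    Function.Injective fun k : ℕ => ((pα ^ L * pβ) ^ s) ^ k := by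
  intro a b hab
  obtain ⟨φ, hα, hβ⟩ := exists_monoidHom_pα_pβ (Multiplicative.ofAdd (1 : ℤ))
  have h := congrArg (fun x => Multiplicative.toAdd (φ x)) hab
  have hs0 : s ≠ 0 := by
    rintro rfl
    simp at hs
  simpa [hα, hβ, hs0] using h

theorem dvd_of_one_add_mul_eq (L : ℤ) {s n : ℤ} (hs : Odd s) {x : MonoidAlgebra ℤ K}
    (hx : (1 + MonoidAlgebra.of ℤ K ((pα ^ L * pβ) ^ s)) * x =
      1 - MonoidAlgebra.of ℤ K (pβ ^ (2 * n))) : s ∣ n := by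
  have hs0 : s ≠ 0 := by
    rintro rfl
    simp at hs
  have hN : 2 * s.natAbs ≠ 0 := by omega
  have hζ := Complex.isPrimitiveRoot_exp _ hN
  set ζ := Complex.exp (2 * Real.pi * Complex.I / ((2 * s.natAbs : ℕ) : ℂ))
  have hζ0 : ζ ≠ 0 := Complex.exp_ne_zero _
  obtain ⟨φ, hα, hβ⟩ := exists_monoidHom_pα_pβ (Units.mk0 ζ hζ0)
  have hdvd (m : ℤ) : ζ ^ m = 1 ↔ 2 * s ∣ m := by
    rw [hζ.zpow_eq_one_iff_dvd, ← Int.natAbs_dvd_natAbs, ← Int.natAbs_dvd_natAbs,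
      Int.natAbs_natCast, Int.natAbs_mul, show (2 : ℤ).natAbs = 2 from rfl]
  have hζs : ζ ^ s = -1 := by
    have h1 : (ζ ^ s) ^ 2 = 1 := by
      rw [← zpow_natCast, ← zpow_mul, hdvd]
      exact ⟨1, by push_cast; ring⟩
    refine (sq_eq_one_iff.1 h1).resolve_left ?_
    rw [hdvd]
    rintro ⟨c, hc⟩
    have : s * (2 * c - 1) = 0 := by linear_combination -hc
    rcases mul_eq_zero.1 this with h | h
    · exact hs0 h
    · omega
  have h := congrArg (MonoidAlgebra.lift ℤ ℂ K ((Units.coeHom ℂ).comp φ)) hx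
  simp only [map_mul, map_add, map_sub, map_one, MonoidAlgebra.lift_of, MonoidHom.comp_apply,
    map_zpow, hα, hβ, Units.coeHom_apply, one_zpow, one_mul, Units.val_mk0, hζs] at h
  have h2 : ζ ^ (2 * n) = 1 := by linear_combination h
  rw [hdvd] at h2
  exact (mul_dvd_mul_iff_left two_ne_zero).1 h2

/-- **Lemma 5.6.**
For `n ∈ ℤ`, the pairs `(x̃, ȳ) ∈ ℤ[π₋] × π₋` with `w₋(ȳ) = -1` satisfying
`(1 + ȳ)·x̃ = 1 - β̄^{2n}` are exactly those of the form `ȳ = (ᾱ^L β̄)^ℓ`,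
`x̃ = altGeom ((ᾱ^L β̄)^ℓ) (2n/ℓ)` (i.e. `1 - c̄^ℓ + c̄^{2ℓ} - ⋯ - c̄^{2n-ℓ}` if `n/ℓ > 0`,
`0` if `n = 0`, and `c̄^{-ℓ} - c̄^{-2ℓ} + ⋯ - c̄^{2n}` if `n/ℓ < 0`), where `L` ranges over
all integers and `ℓ` over the odd divisors of `n` when `n ≠ 0`, over all odd integers
when `n = 0`. -/
theorem statement (n : ℤ) (w : K →* ℤˣ) (hwα : w pα = 1) (hwβ : w pβ = -1)
    (xt : MonoidAlgebra ℤ K) (yb : K) :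
    (w yb = -1 ∧
      (1 + MonoidAlgebra.of ℤ K yb) * xt = 1 - MonoidAlgebra.of ℤ K (pβ ^ (2 * n))) ↔
    (∃ L ℓ : ℤ, Odd ℓ ∧ (n ≠ 0 → ℓ ∣ n) ∧
      yb = (pα ^ L * pβ) ^ ℓ ∧ xt = altGeom ((pα ^ L * pβ) ^ ℓ) (2 * n / ℓ)) := by
  have key (L ℓ : ℤ) (hdvd : ℓ ∣ n) :
      (1 + MonoidAlgebra.of ℤ K ((pα ^ L * pβ) ^ ℓ)) *
          altGeom ((pα ^ L * pβ) ^ ℓ) (2 * n / ℓ) =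
        1 - MonoidAlgebra.of ℤ K (pβ ^ (2 * n)) := by
    have hm : 2 * n / ℓ = 2 * (n / ℓ) := Int.mul_ediv_assoc 2 hdvd
    rw [one_add_of_mul_altGeom _ _ (hm ▸ even_two_mul _), ← zpow_mul,
      Int.mul_ediv_cancel' (hdvd.mul_left 2), pα_zpow_mul_pβ_zpow_two_mul]
  have hw (L s : ℤ) : w (pα ^ L * pβ ^ s) = (-1) ^ s := by
    rw [map_mul, map_zpow, map_zpow, hwα, hwβ, one_zpow, one_mul]
  constructor
  · rintro ⟨hy, hx⟩
    obtain ⟨L, s, rfl⟩ := exists_eq_pα_zpow_mul_pβ_zpow yb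
    rw [hw] at hy
    have hs : Odd s := by
      rw [← Int.not_even_iff_odd]
      intro he
      rw [he.neg_one_zpow] at hy
      exact absurd hy (by decide)
    rw [← pα_zpow_mul_pβ_zpow_of_odd L hs] at hx ⊢
    have hdvd := dvd_of_one_add_mul_eq L hs hx
    refine ⟨L, s, hs, fun _ => hdvd, rfl, sub_eq_zero.1 ?_⟩
    refine eq_zero_of_one_add_of_mul (injective_pow_of_odd L hs) ?_
    rw [mul_sub, hx, key L s hdvd, sub_self]
  · rintro ⟨L, ℓ, hℓ, hdvd, rfl, rfl⟩
    refine ⟨?_, key L ℓ ?_⟩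
    · rw [pα_zpow_mul_pβ_zpow_of_odd L hℓ, hw, hℓ.neg_one_zpow]
    · by_cases hn : n = 0
      · exact hn ▸ dvd_zero ℓ
      · exact hdvd hn

end Stmt11
end

section
/- Let m, n ∈ ℤ and consider the equation (1 + ȳ)·x̃ = 1 − ᾱ^{2m}β̄^{4n} in ℤ[π₋] with unknowns x̃ ∈ ℤ[π₋] and ȳ ∈ π₋ subject to w₋(ȳ) = 1. If (m,n) ≠ (0,0), set d := gcd(m,n) and c̄ := ᾱ^{m/d}β̄^{2n/d}; then the solutions are exactly the pairs ȳ = c̄^{ℓ} with x̃ = Σ_{j=0}^{2d/ℓ−1} (−1)^j c̄^{jℓ} (i.e. 1 − c̄^{ℓ} + c̄^{2ℓ} − ⋯ − c̄^{2d−ℓ}) when ℓ > 0, and x̃ = Σ_{j=1}^{−2d/ℓ} (−1)^{j+1} c̄^{−jℓ} (i.e. c̄^{−ℓ} − c̄^{−2ℓ} + ⋯ + c̄^{2d+ℓ} − c̄^{2d}) when ℓ < 0, where ℓ ranges over all nonzero divisors of d. If m = n = 0, the solutions are exactly the pairs with x̃ = 0 and ȳ ∈ π₋ any element with w₋(ȳ)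 = 1. (Lemma 5.8.) -/
namespace Stmt12

/-- The free group of rank 2, `F₂ = ⟨α, β⟩`. -/
abbrev F2 : Type := FreeGroup (Fin 2)

/-- The generator `α`. -/
def fα : F2 := FreeGroup.of 0

/-- The generator `β`. -/
def fβ : F2 := FreeGroup.of 1

/-- The Klein bottle relator `B = αβαβ⁻¹`. -/
def B : F2 := fα * fβ * fα * fβ⁻¹

/-- The normal closure `N = ⟪αβαβ⁻¹⟫`. -/
abbrev N : Subgroup F2 := Subgroup.normalClosure {B}

/-- The Klein bottle group `π₋ = F₂/⟪αβαβ⁻¹⟫`. -/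
abbrev K := F2 ⧸ N

/-- The image `ᾱ` of `α` in `π₋`. -/
def pα : K := QuotientGroup.mk fα

/-- The image `β̄` of `β` in `π₋`. -/
def pβ : K := QuotientGroup.mk fβ

/-- The "geometric sum" `geom x m := ∑_{i=0}^{m-1} x^i` for `m ≥ 0` and
`geom x m := -∑_{i=m}^{-1} x^i` for `m < 0`, as an element of `ℤ[G]`. -/
noncomputable def geom {G : Type} [Group G] (x : G) (m : ℤ) : MonoidAlgebra ℤ G :=
  if 0 ≤ m then ∑ i ∈ Finset.range m.toNat, MonoidAlgebra.of ℤ G (x ^ (i : ℤ))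
  else -∑ i ∈ Finset.range (-m).toNat, MonoidAlgebra.of ℤ G (x ^ (m + (i : ℤ)))

/-- The alternating "geometric sum" `altGeom x m := ∑_{i=0}^{m-1} (-1)^i x^i` for `m ≥ 0`
and `altGeom x m := ∑_{j=1}^{-m} (-1)^{j+1} x^{-j}` for `m < 0`, as an element of `ℤ[G]`. -/
noncomputable def altGeom {G : Type} [Group G] (x : G) (m : ℤ) : MonoidAlgebra ℤ G :=
  if 0 ≤ m then
    ∑ i ∈ Finset.range m.toNat, ((-1 : ℤ) ^ i) • MonoidAlgebra.of ℤ G (x ^ (i : ℤ))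
  else
    ∑ i ∈ Finset.range (-m).toNat, ((-1 : ℤ) ^ i) • MonoidAlgebra.of ℤ G (x ^ (-(i : ℤ) - 1))

/-- The generators of the Klein bottle group satisfy `βαβ⁻¹ = α⁻¹`. -/
theorem pβ_conj_pα : pβ * pα * pβ⁻¹ = pα⁻¹ := by
  have h : pα * pβ * pα * pβ⁻¹ = 1 :=
    (QuotientGroup.eq_one_iff B).2 (Subgroup.subset_normalClosure rfl)
  have h' : pα * (pβ * pα * pβ⁻¹) = 1 := by simpa only [mul_assoc] using h
  exact (mul_eq_one_iff_inv_eq.1 h').symm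

theorem pβ_conj_pα_zpow (r : ℤ) : pβ * pα ^ r * pβ⁻¹ = pα ^ (-r) := by
  rw [← conj_zpow, pβ_conj_pα, inv_zpow, zpow_neg]

theorem commute_pα_pβ_sq : Commute pα (pβ ^ (2 : ℤ)) := by
  have h : pβ * (pβ * pα * pβ⁻¹) * pβ⁻¹ = pα := by
    simpa [pβ_conj_pα] using pβ_conj_pα_zpow (-1)
  have h2 : pβ ^ (2 : ℤ) * pα * (pβ ^ (2 : ℤ))⁻¹ = pα := by
    rw [zpow_two]
    simpa only [mul_assoc, mul_inv_rev] using h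
  exact (mul_inv_eq_iff_eq_mul.1 h2).symm

/-- Powers of elements of the orientation subgroup `⟨α, β²⟩`. -/
theorem orientable_zpow (r s k : ℤ) :
    (pα ^ r * pβ ^ (2 * s)) ^ k = pα ^ (r * k) * pβ ^ (2 * (s * k)) := by
  have hc : Commute (pα ^ r) (pβ ^ (2 * s)) := by
    rw [zpow_mul]
    exact commute_pα_pβ_sq.zpow_zpow r s
  rw [hc.mul_zpow, ← zpow_mul, ← zpow_mul, mul_assoc]

/-- Every element of the Klein bottle group has the form `α ^ r * β ^ s`. -/
theorem exists_normal_form (x : K) : ∃ r s : ℤ, x = pα ^ r * pβ ^ s := by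
  have hβ (r s : ℤ) : pβ * (pα ^ r * pβ ^ s) = pα ^ (-r) * pβ ^ (s + 1) := by
    rw [← pβ_conj_pα_zpow, add_comm, zpow_one_add]
    group
  have hβ' (r s : ℤ) : pβ⁻¹ * (pα ^ r * pβ ^ s) = pα ^ (-r) * pβ ^ (s - 1) := by
    rw [inv_mul_eq_iff_eq_mul, hβ, neg_neg, sub_add_cancel]
  induction x using QuotientGroup.induction_on with
  | H z =>
    have hz : z ∈ Subgroup.closure (Set.range FreeGroup.of) := by
      rw [FreeGroup.closure_range_of]
      exact Subgroup.mem_top z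
    induction hz using Subgroup.closure_induction_left with
    | one => exact ⟨0, 0, by simp⟩
    | mul_left _ hi z _ ih =>
      obtain ⟨i, rfl⟩ := hi
      obtain ⟨r, s, h⟩ := ih
      rw [QuotientGroup.mk_mul, h]
      fin_cases i
      · exact ⟨1 + r, s, by rw [zpow_one_add, mul_assoc]; rfl⟩
      · exact ⟨-r, s + 1, hβ r s⟩
    | inv_mul_cancel _ hi z _ ih =>
      obtain ⟨i, rfl⟩ := hi
      obtain ⟨r, s, h⟩ := ih
      rw [QuotientGroup.mk_mul, h]
      fin_cases i
      · exact ⟨-1 + r, s, by rw [zpow_add, zpow_neg_one, mul_assoc]; rfl⟩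
      · exact ⟨-r, s - 1, hβ' r s⟩

/-- The translation `(x, y) ↦ (x + 1, y)` of the lattice `ℤ²`. -/
def translation : Equiv.Perm (ℤ × ℤ) where
  toFun p := (p.1 + 1, p.2)
  invFun p := (p.1 - 1, p.2)
  left_inv p := by simp
  right_inv p := by simp

/-- The glide reflection `(x, y) ↦ (-x, y + 1)` of the lattice `ℤ²`. -/
def glide : Equiv.Perm (ℤ × ℤ) where
  toFun p := (-p.1, p.2 + 1)
  invFun p := (-p.1, p.2 - 1)
  left_inv p := by simp
  right_inv p := by simp

/-- The action of the Klein bottle group on the lattice `ℤ²`. -/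
def latticeAction : K →* Equiv.Perm (ℤ × ℤ) :=
  QuotientGroup.lift N (FreeGroup.lift ![translation, glide]) (by
    apply Subgroup.normalClosure_le_normal
    rintro _ rfl
    simp only [SetLike.mem_coe, MonoidHom.mem_ker, B, fα, fβ, map_mul, map_inv,
      FreeGroup.lift_apply_of]
    ext p <;> simp [translation, glide, Equiv.Perm.mul_apply, Equiv.Perm.inv_def])

theorem latticeAction_pα : latticeAction pα = translation :=
  FreeGroup.lift_apply_of

theorem latticeAction_pβ : latticeAction pβ = glide :=
  FreeGroup.lift_apply_of

theorem translation_zpow_apply (r : ℤ) (p : ℤ × ℤ) : (translation ^ r) p = (p.1 + r, p.2) := by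
  induction r with
  | zero => simp
  | succ r ih =>
    rw [add_comm, zpow_one_add, Equiv.Perm.mul_apply, ih]
    simp [translation]
    ring
  | pred r ih =>
    rw [sub_eq_neg_add, zpow_add, zpow_neg_one, Equiv.Perm.mul_apply, ih]
    simp [translation, Equiv.Perm.inv_def]
    ring

theorem glide_zpow_apply (s y : ℤ) : (glide ^ s) (0, y) = (0, y + s) := by
  induction s with
  | zero => simp
  | succ r ih =>
    rw [add_comm, zpow_one_add, Equiv.Perm.mul_apply, ih]
    simp [glide]
    ring
  | pred r ih =>
    rw [sub_eq_neg_add, zpow_add, zpow_neg_one, Equiv.Perm.mul_apply, ih]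
    simp [glide, Equiv.Perm.inv_def]
    ring

/-- The form `α ^ r * β ^ s` of an element of the Klein bottle group is unique. -/
theorem normal_form_injective {r s r' s' : ℤ} (h : pα ^ r * pβ ^ s = pα ^ r' * pβ ^ s') :
    r = r' ∧ s = s' := by
  simpa [latticeAction_pα, latticeAction_pβ, translation_zpow_apply, glide_zpow_apply] using
    congrArg (fun x => latticeAction x (0, 0)) h

theorem eq_zero_of_monotone_of_finite {F : ℤ → ℤ} (hF : Monotone F)
    (hfin : {k | F k ≠ 0}.Finite) (k : ℤ) : F k = 0 := by
  obtain ⟨u, hu⟩ := hfin.bddAbove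
  obtain ⟨l, hl⟩ := hfin.bddBelow
  have h₁ : F (max k (u + 1)) = 0 := by
    by_contra h
    have := hu h
    omega
  have h₂ : F (min k (l - 1)) = 0 := by
    by_contra h
    have := hl h
    omega
  exact le_antisymm (h₁ ▸ hF (le_max_left k (u + 1))) (h₂ ▸ hF (min_le_left k (l - 1)))

section GroupRing

variable {G : Type} [Group G]

/-- The coefficients along an orbit of an element `y`, with alternating signs. -/
noncomputable def signedCoeff (x : MonoidAlgebra ℤ G) (y h : G) (k : ℤ) : ℤ :=
  (((-1 : ℤˣ) ^ k : ℤˣ) : ℤ) * x.coeff (y ^ k * h)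

theorem signedCoeff_finite (x : MonoidAlgebra ℤ G) {y : G}
    (hy : Function.Injective fun k : ℤ => y ^ k) (h : G) :
    {k | signedCoeff x y h k ≠ 0}.Finite := by
  have hinj : Function.Injective fun k : ℤ => y ^ k * h :=
    (mul_left_injective h).comp hy
  refine (x.coeff.hasFiniteSupport.preimage hinj.injOn).subset fun k hk => ?_
  exact right_ne_zero_of_mul hk

theorem signedCoeff_succ_sub (x : MonoidAlgebra ℤ G) (y h : G) (k : ℤ) :
    signedCoeff x y h (k + 1) - signedCoeff x y h k =
      signedCoeff ((1 + MonoidAlgebra.of ℤ G y) * x) y h (k + 1) := by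
  have hk : y⁻¹ * (y ^ (k + 1) * h) = y ^ k * h := by
    rw [add_comm, zpow_one_add]
    group
  simp only [signedCoeff, add_mul, one_mul, MonoidAlgebra.of_apply, MonoidAlgebra.coeff_add,
    Finsupp.add_apply, MonoidAlgebra.coeff_single_mul_apply, hk]
  rw [zpow_add_one (-1 : ℤˣ)]
  push_cast
  ring

/-- `1 + y` is left cancellable in the group ring if `y` has infinite order. -/
theorem eq_zero_of_one_add_of_mul_eq_zero {x : MonoidAlgebra ℤ G} {y : G}
    (hy : Function.Injective fun k : ℤ => y ^ k)
    (hx : (1 + MonoidAlgebra.of ℤ G y) * x = 0) : x = 0 := by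
  ext h
  have hmono : Monotone (signedCoeff x y h) := by
    refine monotone_int_of_le_succ fun k => ?_
    have := signedCoeff_succ_sub x y h k
    rw [hx] at this
    simp only [signedCoeff, MonoidAlgebra.coeff_zero, Finsupp.coe_zero, Pi.zero_apply,
      mul_zero] at this ⊢
    omega
  simpa [signedCoeff] using eq_zero_of_monotone_of_finite hmono (signedCoeff_finite x hy h) 0

/-- If `1 + y` divides `1 - g` and `y` has infinite order, then `g` is an even power of `y`. -/
theorem exists_even_zpow_eq {x : MonoidAlgebra ℤ G} {y g : G}
    (hy : Function.Injective fun k : ℤ => y ^ k)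
    (hx : (1 + MonoidAlgebra.of ℤ G y) * x = 1 - MonoidAlgebra.of ℤ G g) :
    ∃ k : ℤ, y ^ (2 * k) = g := by
  classical
  by_contra! hne
  have hodd (k : ℤ) (hk : g = y ^ k) : Odd k := by
    by_contra h
    obtain ⟨j, rfl⟩ := (Int.not_odd_iff_even.1 h).two_dvd
    exact hne j hk.symm
  have hone (k : ℤ) : 1 = y ^ k ↔ k = 0 :=
    ⟨fun h => hy (by simpa using h.symm), fun h => by simp [h]⟩
  have key (k : ℤ) : (if k = 0 then 1 else 0) ≤ signedCoeff (1 - MonoidAlgebra.of ℤ G g) y 1 k := by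
    simp only [signedCoeff, mul_one, MonoidAlgebra.of_apply, MonoidAlgebra.coeff_sub,
      Finsupp.sub_apply, MonoidAlgebra.one_def, MonoidAlgebra.coeff_single,
      Finsupp.single_apply, hone]
    by_cases hg : g = y ^ k
    · have := hodd k hg
      have h0 : k ≠ 0 := by rintro rfl; simp at this
      simp [hg, h0, this.neg_one_zpow]
    · by_cases h0 : k = 0
      · subst h0
        rw [zpow_zero] at hg
        simp [hg]
      · simp [hg, h0]
  have hstep (k : ℤ) := hx ▸ signedCoeff_succ_sub x y 1 k
  have hmono : Monotone (signedCoeff x y 1) := by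
    refine monotone_int_of_le_succ fun k => ?_
    have h₁ := hstep k
    have h₂ := key (k + 1)
    split_ifs at h₂ <;> omega
  have hzero := eq_zero_of_monotone_of_finite hmono (signedCoeff_finite x hy 1)
  have h₁ := hstep (-1)
  have h₂ := key (-1 + 1)
  rw [hzero, hzero] at h₁
  rw [← h₁] at h₂
  simp at h₂

theorem one_add_of_mul_alternating_sum (y : G) (N : ℕ) :
    (1 + MonoidAlgebra.of ℤ G y) *
        ∑ i ∈ Finset.range N, ((-1 : ℤ) ^ i) • MonoidAlgebra.of ℤ G (y ^ (i : ℤ)) =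
      1 - ((-1 : ℤ) ^ N) • MonoidAlgebra.of ℤ G (y ^ (N : ℤ)) := by
  induction N with
  | zero => simp [-MonoidAlgebra.of_apply]
  | succ N ih =>
    rw [Finset.sum_range_succ, mul_add, ih, pow_succ, add_mul, one_mul, mul_smul_comm,
      ← map_mul, ← zpow_one_add, add_comm 1, Nat.cast_succ, mul_neg_one, neg_smul]
    abel

/-- The alternating geometric sum of even length telescopes. -/
theorem one_add_of_mul_altGeom (y : G) (k : ℤ) :
    (1 + MonoidAlgebra.of ℤ G y) * altGeom y (2 * k) =
      1 - MonoidAlgebra.of ℤ G (y ^ (2 * k)) := by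
  unfold altGeom
  split_ifs with h
  · rw [one_add_of_mul_alternating_sum, Int.toNat_of_nonneg h,
      Even.neg_one_pow ⟨k.toNat, by omega⟩, one_smul]
  · have hN : (((-(2 * k)).toNat : ℕ) : ℤ) = -(2 * k) := Int.toNat_of_nonneg (by omega)
    have hterm (i : ℕ) : MonoidAlgebra.of ℤ G (y ^ (-(i : ℤ) - 1)) =
        MonoidAlgebra.of ℤ G y⁻¹ * MonoidAlgebra.of ℤ G (y⁻¹ ^ (i : ℤ)) := by
      rw [← map_mul, ← zpow_one_add, inv_zpow', neg_add', sub_eq_add_neg, sub_eq_add_neg,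
        add_comm]
    have hy : (1 + MonoidAlgebra.of ℤ G y) * MonoidAlgebra.of ℤ G y⁻¹ =
        1 + MonoidAlgebra.of ℤ G y⁻¹ := by
      rw [add_mul, one_mul, ← map_mul, mul_inv_cancel, map_one, add_comm]
    simp only [hterm, ← mul_smul_comm, ← Finset.mul_sum]
    rw [← mul_assoc, hy, one_add_of_mul_alternating_sum, hN,
      Even.neg_one_pow ⟨(-k).toNat, by omega⟩, one_smul, inv_zpow', neg_neg]

end GroupRing

/-- An orientation preserving element lies in `⟨α, β²⟩`. -/
theorem exists_orientable_form (w : K →* ℤˣ) (hwα : w pα = 1) (hwβ : w pβ = -1) {y : K}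
    (hy : w y = 1) : ∃ p q : ℤ, y = pα ^ p * pβ ^ (2 * q) := by
  obtain ⟨p, s, rfl⟩ := exists_normal_form y
  simp only [map_mul, map_zpow, hwα, hwβ, one_zpow, one_mul] at hy
  rcases Int.even_or_odd s with hs | hs
  · obtain ⟨q, rfl⟩ := hs.two_dvd
    exact ⟨p, q, rfl⟩
  · rw [hs.neg_one_zpow] at hy
    exact absurd hy (by decide)

theorem orientable_zpow_injective {p q : ℤ} (h : pα ^ p * pβ ^ (2 * q) ≠ 1) :
    Function.Injective fun k : ℤ => (pα ^ p * pβ ^ (2 * q)) ^ k := by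
  intro j k hjk
  simp only [orientable_zpow] at hjk
  obtain ⟨h₁, h₂⟩ := normal_form_injective hjk
  by_contra hne
  have hp : p = 0 := by
    by_contra hp
    exact hne (mul_left_cancel₀ hp h₁)
  have hq : q = 0 := by
    by_contra hq
    exact hne (mul_left_cancel₀ hq (mul_left_cancel₀ two_ne_zero h₂))
  simp [hp, hq] at h

/-- `1 + y` is left cancellable in the group ring if `y` preserves the orientation. -/
theorem eq_zero_of_orientable (w : K →* ℤˣ) (hwα : w pα = 1) (hwβ : w pβ = -1) {y : K}
    (hy : w y = 1) {x : MonoidAlgebra ℤ K} (hx : (1 + MonoidAlgebra.of ℤ K y) * x = 0) :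
    x = 0 := by
  by_cases h1 : y = 1
  · ext h
    have := congrArg (fun z : MonoidAlgebra ℤ K => z.coeff h) hx
    simp only [h1, map_one, add_mul, one_mul, MonoidAlgebra.coeff_add, Finsupp.add_apply,
      MonoidAlgebra.coeff_zero, Finsupp.coe_zero, Pi.zero_apply] at this ⊢
    omega
  · obtain ⟨p, q, rfl⟩ := exists_orientable_form w hwα hwβ hy
    exact eq_zero_of_one_add_of_mul_eq_zero (orientable_zpow_injective h1) hx

/-- **Lemma 5.8.**
Let `m, n ∈ ℤ` and consider `(1 + ȳ)·x̃ = 1 - ᾱ^{2m}β̄^{4n}` in `ℤ[π₋]`, with unknowns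
`x̃ ∈ ℤ[π₋]`, `ȳ ∈ π₋` subject to `w₋(ȳ) = 1`.  If `(m,n) ≠ (0,0)` then, with
`d = gcd(m,n)` and `c̄ = ᾱ^{m/d}β̄^{2n/d}`, the solutions are exactly the pairs
`ȳ = c̄^ℓ`, `x̃ = altGeom (c̄^ℓ) (2d/ℓ)`, where `ℓ` ranges over the nonzero divisors
of `d`.  If `m = n = 0`, the solutions are exactly the pairs with `x̃ = 0` and `ȳ` any
element with `w₋(ȳ) = 1`. -/
theorem statement (m n : ℤ) (w : K →* ℤˣ) (hwα : w pα = 1) (hwβ : w pβ = -1)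
    (xt : MonoidAlgebra ℤ K) (yb : K) :
    (¬(m = 0 ∧ n = 0) →
      ((w yb = 1 ∧
          (1 + MonoidAlgebra.of ℤ K yb) * xt =
            1 - MonoidAlgebra.of ℤ K (pα ^ (2 * m) * pβ ^ (4 * n))) ↔
        (∃ ℓ : ℤ, ℓ ≠ 0 ∧ ℓ ∣ (Int.gcd m n : ℤ) ∧
          yb = (pα ^ (m / (Int.gcd m n : ℤ)) * pβ ^ (2 * n / (Int.gcd m n : ℤ))) ^ ℓ ∧
          xt = altGeom
            ((pα ^ (m / (Int.gcd m n : ℤ)) * pβ ^ (2 * n / (Int.gcd m n : ℤ))) ^ ℓ)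
            (2 * (Int.gcd m n : ℤ) / ℓ)))) ∧
    ((m = 0 ∧ n = 0) →
      ((w yb = 1 ∧
          (1 + MonoidAlgebra.of ℤ K yb) * xt =
            1 - MonoidAlgebra.of ℤ K (pα ^ (2 * m) * pβ ^ (4 * n))) ↔
        (w yb = 1 ∧ xt = 0))) := by
  refine ⟨fun hmn => ?_, ?_⟩
  · obtain ⟨a, ha⟩ : (Int.gcd m n : ℤ) ∣ m := Int.gcd_dvd_left m n
    obtain ⟨b, hb⟩ : (Int.gcd m n : ℤ) ∣ n := Int.gcd_dvd_right m n
    have hdvd (k : ℤ) (h₁ : k ∣ m) (h₂ : k ∣ n) : k ∣ (Int.gcd m n : ℤ) := Int.dvd_coe_gcd h₁ h₂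
    have hd : (Int.gcd m n : ℤ) ≠ 0 := by
      rw [Ne, Int.natCast_eq_zero, Int.gcd_eq_zero_iff]
      exact hmn
    generalize (Int.gcd m n : ℤ) = d at *
    have hmd : m / d = a := by rw [ha, Int.mul_ediv_cancel_left _ hd]
    have hnd : 2 * n / d = 2 * b := by rw [hb, mul_left_comm, Int.mul_ediv_cancel_left _ hd]
    rw [hmd, hnd]
    have hdiv {ℓ k : ℤ} (hℓ : ℓ ≠ 0) (hk : d = ℓ * k) : 2 * d / ℓ = 2 * k := by
      rw [hk, mul_left_comm, Int.mul_ediv_cancel_left _ hℓ]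
    have hsol {ℓ k : ℤ} (hk : d = ℓ * k) :
        (1 + MonoidAlgebra.of ℤ K ((pα ^ a * pβ ^ (2 * b)) ^ ℓ)) *
            altGeom ((pα ^ a * pβ ^ (2 * b)) ^ ℓ) (2 * k) =
          1 - MonoidAlgebra.of ℤ K (pα ^ (2 * m) * pβ ^ (4 * n)) := by
      rw [one_add_of_mul_altGeom, ← zpow_mul, orientable_zpow, ha, hb, hk]
      ring_nf
    constructor
    · rintro ⟨hw, hx⟩
      obtain ⟨p, q, rfl⟩ := exists_orientable_form w hwα hwβ hw
      have hy : pα ^ p * pβ ^ (2 * q) ≠ 1 := by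
        intro hy
        have hg : pα ^ (2 * m) * pβ ^ (4 * n) ≠ 1 := by
          intro hg
          have := normal_form_injective (r' := 0) (s' := 0) (by simpa using hg)
          omega
        have := congrArg (fun z : MonoidAlgebra ℤ K => z.coeff 1) hx
        simp only [hy, map_one, add_mul, one_mul, MonoidAlgebra.coeff_add, Finsupp.add_apply,
          MonoidAlgebra.coeff_sub, Finsupp.sub_apply, MonoidAlgebra.coeff_one_one,
          MonoidAlgebra.of_apply, MonoidAlgebra.coeff_single,
          Finsupp.single_eq_of_ne hg.symm] at this
        omega
      obtain ⟨k, hk⟩ := exists_even_zpow_eq (orientable_zpow_injective hy) hx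
      rw [orientable_zpow] at hk
      obtain ⟨h₁, h₂⟩ := normal_form_injective hk
      have hm : m = k * p := by linarith
      have hn : n = k * q := by linarith
      obtain ⟨ℓ, hℓ⟩ := hdvd k ⟨p, hm⟩ ⟨q, hn⟩
      have hk0 : k ≠ 0 := left_ne_zero_of_mul (hℓ ▸ hd)
      have hℓ0 : ℓ ≠ 0 := right_ne_zero_of_mul (hℓ ▸ hd)
      have hdk : d = ℓ * k := by rw [hℓ, mul_comm]
      have hp : p = a * ℓ := mul_left_cancel₀ hk0 (by rw [← hm, ha, hℓ]; ring)
      have hq : q = b * ℓ := mul_left_cancel₀ hk0 (by rw [← hn, hb, hℓ]; ring)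
      have hyc : pα ^ p * pβ ^ (2 * q) = (pα ^ a * pβ ^ (2 * b)) ^ ℓ := by
        rw [orientable_zpow, hp, hq]
      refine ⟨ℓ, hℓ0, ⟨k, hdk⟩, hyc, ?_⟩
      rw [hdiv hℓ0 hdk]
      refine sub_eq_zero.1 (eq_zero_of_orientable w hwα hwβ hw ?_)
      rw [mul_sub, hx, hyc, hsol hdk, sub_self]
    · rintro ⟨ℓ, hℓ0, ⟨k, hk⟩, rfl, rfl⟩
      refine ⟨?_, by rw [hdiv hℓ0 hk, hsol hk]⟩
      rw [orientable_zpow]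
      simp [hwα, hwβ, zpow_mul]
  · rintro ⟨rfl, rfl⟩
    refine and_congr_right fun hw => ⟨fun hx => ?_, ?_⟩
    · exact eq_zero_of_orientable w hwα hwβ hw (by simpa [-MonoidAlgebra.of_apply] using hx)
    · rintro rfl
      simp [-MonoidAlgebra.of_apply]

end Stmt12
end

section
/- In the free group F₂ = ⟨α,β⟩, with B := αβαβ⁻¹ and B_u := uBu⁻¹, for every L ∈ ℤ: α^{L}βα^{L}β⁻¹ = B_{α^{L−1}}·B_{α^{L−2}}·⋯·B_{α}·B (a product of L factors) if L ≥ 0, and α^{L}βα^{L}β⁻¹ = B_{α^{L}}⁻¹·B_{α^{L+1}}⁻¹·⋯·B_{α^{−1}}⁻¹ (a product of |L| factors) if L < 0; in particular α^{L}βα^{L}β⁻¹ ∈ N := ⟪B⟫. Moreover, with π₋ = F₂/N and q_N : N → ℤ[π₋] the homomorphism with q_N(uBu⁻¹) = ū, one has q_N(α^{L}βα^{L}β⁻¹) = Σ_{i=0}^{L−1} ᾱ^{i} for L ≥ 0, and q_N(α^{L}βα^{L}β⁻¹) = −Σ_{i=L}^{−1} ᾱ^{i} for L < 0. (Lemma 5.11.)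 -/
namespace Stmt13

/-- The free group of rank 2, `F₂ = ⟨α, β⟩`. -/
abbrev F2 : Type := FreeGroup (Fin 2)

/-- The generator `α`. -/
def fα : F2 := FreeGroup.of 0

/-- The generator `β`. -/
def fβ : F2 := FreeGroup.of 1

/-- The Klein bottle relator `B = αβαβ⁻¹`. -/
def B : F2 := fα * fβ * fα * fβ⁻¹

/-- The normal closure `N = ⟪αβαβ⁻¹⟫`. -/
abbrev N : Subgroup F2 := Subgroup.normalClosure {B}

/-- The Klein bottle group `π₋ = F₂/⟪αβαβ⁻¹⟫`. -/
abbrev K := F2 ⧸ N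

/-- The image `ᾱ` of `α` in `π₋`. -/
def pα : K := QuotientGroup.mk fα

/-- The image `β̄` of `β` in `π₋`. -/
def pβ : K := QuotientGroup.mk fβ

/-- The "geometric sum" `geom x m := ∑_{i=0}^{m-1} x^i` for `m ≥ 0` and
`geom x m := -∑_{i=m}^{-1} x^i` for `m < 0`, as an element of `ℤ[G]`. -/
noncomputable def geom {G : Type} [Group G] (x : G) (m : ℤ) : MonoidAlgebra ℤ G :=
  if 0 ≤ m then ∑ i ∈ Finset.range m.toNat, MonoidAlgebra.of ℤ G (x ^ (i : ℤ))
  else -∑ i ∈ Finset.range (-m).toNat, MonoidAlgebra.of ℤ G (x ^ (m + (i : ℤ)))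

/-- The alternating "geometric sum" `altGeom x m := ∑_{i=0}^{m-1} (-1)^i x^i` for `m ≥ 0`
and `altGeom x m := ∑_{j=1}^{-m} (-1)^{j+1} x^{-j}` for `m < 0`, as an element of `ℤ[G]`. -/
noncomputable def altGeom {G : Type} [Group G] (x : G) (m : ℤ) : MonoidAlgebra ℤ G :=
  if 0 ≤ m then
    ∑ i ∈ Finset.range m.toNat, ((-1 : ℤ) ^ i) • MonoidAlgebra.of ℤ G (x ^ (i : ℤ))
  else
    ∑ i ∈ Finset.range (-m).toNat, ((-1 : ℤ) ^ i) • MonoidAlgebra.of ℤ G (x ^ (-(i : ℤ) - 1))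

/-- The recursion `geom x (m + 1) = x ^ m + geom x m`, valid for every integer `m`. -/
theorem geom_add_one {G : Type} [Group G] (x : G) (m : ℤ) :
    geom x (m + 1) = MonoidAlgebra.of ℤ G (x ^ m) + geom x m := by
  obtain ⟨n, rfl | rfl⟩ : ∃ n : ℕ, m = n ∨ m = -((n : ℤ) + 1) :=
    ⟨if 0 ≤ m then m.toNat else (-m - 1).toNat, by split_ifs <;> omega⟩
  · have h : ((n : ℤ) + 1).toNat = n + 1 := by omega
    rw [geom, geom, if_pos (by omega), if_pos (by omega), h, Int.toNat_natCast,
      Finset.sum_range_succ, add_comm]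
  · have h : (-(-((n : ℤ) + 1))).toNat = n + 1 := by omega
    have hneg : geom x (-((n : ℤ) + 1)) =
        -∑ i ∈ Finset.range (n + 1), MonoidAlgebra.of ℤ G (x ^ (-((n : ℤ) + 1) + (i : ℤ))) := by
      rw [geom, if_neg (by omega), h]
    rw [hneg, Finset.sum_range_succ', Nat.cast_zero, add_zero, add_comm (Finset.sum _ _), neg_add (MonoidAlgebra.of ℤ G _),
      add_neg_cancel_left]
    rcases Nat.eq_zero_or_pos n with rfl | hn
    · simp [geom]
    · have h' : (-(-((n : ℤ) + 1) + 1)).toNat = n := by omega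
      rw [geom, if_neg (by omega), h']
      refine congrArg _ (Finset.sum_congr rfl fun i _ => ?_)
      congr 2
      push_cast
      ring

theorem zpow_add_one_word (m : ℤ) :
    fα ^ (m + 1) * fβ * fα ^ (m + 1) * fβ⁻¹ =
      (fα ^ m * B * (fα ^ m)⁻¹) * (fα ^ m * fβ * fα ^ m * fβ⁻¹) := by
  have h : fα ^ (m + 1) = fα * fα ^ m := by rw [add_comm, zpow_one_add]
  nth_rewrite 1 [zpow_add_one]
  rw [h, B]
  group

theorem zpow_natCast_word (n : ℕ) :
    fα ^ (n : ℤ) * fβ * fα ^ (n : ℤ) * fβ⁻¹ =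
      (List.ofFn fun i : Fin n =>
        fα ^ ((n : ℤ) - 1 - (i : ℤ)) * B * (fα ^ ((n : ℤ) - 1 - (i : ℤ)))⁻¹).prod := by
  induction n with
  | zero => simp
  | succ n ih =>
    have h (i : Fin n) : ((n : ℤ) + 1) - 1 - ((i : ℤ) + 1) = n - 1 - i := by ring
    have h₀ : (n : ℤ) + 1 - 1 - 0 = n := by ring
    rw [Nat.cast_succ, zpow_add_one_word, ih, List.ofFn_succ, List.prod_cons]
    simp only [Fin.val_zero, Fin.val_succ, Nat.cast_zero, Nat.cast_succ, h₀, h]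

theorem zpow_neg_natCast_word (n : ℕ) :
    fα ^ (-(n : ℤ)) * fβ * fα ^ (-(n : ℤ)) * fβ⁻¹ =
      (List.ofFn fun i : Fin n =>
        (fα ^ (-(n : ℤ) + (i : ℤ)) * B * (fα ^ (-(n : ℤ) + (i : ℤ)))⁻¹)⁻¹).prod := by
  induction n with
  | zero => simp
  | succ n ih =>
    have h (i : Fin n) : -((n : ℤ) + 1) + ((i : ℤ) + 1) = -n + i := by ring
    have hstep := zpow_add_one_word (-((n : ℤ) + 1))
    rw [show -((n : ℤ) + 1) + 1 = -n by ring, ih] at hstep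
    rw [Nat.cast_succ, List.ofFn_succ, List.prod_cons, eq_inv_mul_of_mul_eq hstep.symm]
    simp only [Fin.val_zero, Fin.val_succ, Nat.cast_zero, Nat.cast_succ, add_zero, h]

theorem conj_B_mem (u : F2) : u * B * u⁻¹ ∈ N :=
  Subgroup.normalClosure_normal.conj_mem _
    (Subgroup.subset_normalClosure (Set.mem_singleton B)) u

theorem zpow_word_mem (m : ℤ) : fα ^ m * fβ * fα ^ m * fβ⁻¹ ∈ N := by
  induction m using Int.induction_on with
  | zero => simp
  | succ n ih =>
    rw [zpow_add_one_word]
    exact mul_mem (conj_B_mem _) ih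
  | pred n ih =>
    rw [← sub_add_cancel (-(n : ℤ)) 1, zpow_add_one_word] at ih
    exact (Subgroup.mul_mem_cancel_left _ (conj_B_mem _)).1 ih

theorem map_zpow_word (qN : (N : Subgroup F2) →* Multiplicative (MonoidAlgebra ℤ K))
    (hqN : ∀ (u : F2) (hu : u * B * u⁻¹ ∈ N),
      qN ⟨u * B * u⁻¹, hu⟩ =
        Multiplicative.ofAdd (MonoidAlgebra.of ℤ K (QuotientGroup.mk u)))
    (m : ℤ) :
    qN ⟨fα ^ m * fβ * fα ^ m * fβ⁻¹, zpow_word_mem m⟩ = Multiplicative.ofAdd (geom pα m) := by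
  have hstep (k : ℤ) : qN ⟨fα ^ (k + 1) * fβ * fα ^ (k + 1) * fβ⁻¹, zpow_word_mem (k + 1)⟩ =
      Multiplicative.ofAdd (MonoidAlgebra.of ℤ K (pα ^ k)) *
        qN ⟨fα ^ k * fβ * fα ^ k * fβ⁻¹, zpow_word_mem k⟩ := by
    rw [pα, ← QuotientGroup.mk_zpow, ← hqN _ (conj_B_mem _), ← map_mul]
    exact congrArg qN (Subtype.ext (zpow_add_one_word k))
  induction m using Int.induction_on with
  | zero =>
    have h : (⟨fα ^ (0 : ℤ) * fβ * fα ^ (0 : ℤ) * fβ⁻¹, zpow_word_mem 0⟩ : N) = 1 :=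
      Subtype.ext (by simp)
    rw [h, map_one]
    simp [geom]
  | succ n ih => rw [hstep, ih, geom_add_one, ofAdd_add]
  | pred n ih =>
    have h := hstep (-(n : ℤ) - 1)
    have hg := geom_add_one pα (-(n : ℤ) - 1)
    simp only [sub_add_cancel] at h hg
    rw [ih, hg, ofAdd_add] at h
    exact (mul_left_cancel h).symm

/-- **Lemma 5.11.**
In `F₂ = ⟨α,β⟩`, with `B = αβαβ⁻¹` and `B_u = uBu⁻¹`, for every `L ∈ ℤ` one has
`α^L β α^L β⁻¹ = B_{α^{L-1}} B_{α^{L-2}} ⋯ B_α B` if `L ≥ 0` and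
`α^L β α^L β⁻¹ = B_{α^L}⁻¹ B_{α^{L+1}}⁻¹ ⋯ B_{α^{-1}}⁻¹` if `L < 0`; in particular
`α^L β α^L β⁻¹ ∈ N = ⟪B⟫`, and the homomorphism `q_N : N → (ℤ[π₋],+)` determined by
`q_N(uBu⁻¹) = ū` sends it to `∑_{i=0}^{L-1} ᾱ^i` for `L ≥ 0` and `-∑_{i=L}^{-1} ᾱ^i`
for `L < 0` (that is, to `geom ᾱ L`). -/
theorem statement (L : ℤ)
    (qN : (N : Subgroup F2) →* Multiplicative (MonoidAlgebra ℤ K))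
    (hqN : ∀ (u : F2) (hu : u * B * u⁻¹ ∈ N),
      qN ⟨u * B * u⁻¹, hu⟩ =
        Multiplicative.ofAdd (MonoidAlgebra.of ℤ K (QuotientGroup.mk u))) :
    (0 ≤ L → fα ^ L * fβ * fα ^ L * fβ⁻¹ =
      (List.ofFn fun i : Fin L.toNat =>
        fα ^ (L - 1 - (i : ℤ)) * B * (fα ^ (L - 1 - (i : ℤ)))⁻¹).prod) ∧
    (L < 0 → fα ^ L * fβ * fα ^ L * fβ⁻¹ =
      (List.ofFn fun i : Fin (-L).toNat =>
        (fα ^ (L + (i : ℤ)) * B * (fα ^ (L + (i : ℤ)))⁻¹)⁻¹).prod) ∧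
    ∃ hmem : fα ^ L * fβ * fα ^ L * fβ⁻¹ ∈ N,
      qN ⟨fα ^ L * fβ * fα ^ L * fβ⁻¹, hmem⟩ = Multiplicative.ofAdd (geom pα L) := by
  refine ⟨fun hL => ?_, fun hL => ?_, zpow_word_mem L, map_zpow_word qN hqN L⟩
  · lift L to ℕ using hL
    exact zpow_natCast_word L
  · obtain ⟨n, rfl⟩ := Int.exists_eq_neg_ofNat hL.le
    have h : (-(-(n : ℤ))).toNat = n := by omega
    rw [h]
    exact zpow_neg_natCast_word n

end Stmt13
end

section
/- Let n ∈ ℤ∖{0}, L ∈ ℤ, c_L := βα^{−L} ∈ F₂, and B := αβαβ⁻¹. Then β^{−2n}·c_L^{2n} = ∏_{j=0}^{n−1} β^{1−2n+2j}·(α^{−L}βα^{−L}β⁻¹)·β^{2n−2j−1} if n > 0, and β^{−2n}·c_L^{2n} = ∏_{j=1}^{−n} β^{1−2n−2j}·(α^{−L}βα^{−L}β⁻¹)⁻¹·β^{2n+2j−1} if n < 0 (products taken in the indicated order); in particular β^{−2n}c_L^{2n} belongs to N = ⟪B⟫. Moreover q_N(β^{−2n}c_L^{2n}) = −β̄·Λ·Γ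 in ℤ[π₋], where Λ := −Σ_{j=1}^{n} β̄^{−2j} for n > 0 and Λ := Σ_{j=0}^{−n−1} β̄^{2j} for n < 0 (so (1−β̄²)·Λ = 1−β̄^{−2n}), and Γ := Σ_{i=0}^{−L−1} ᾱ^{i} for L ≤ 0 and Γ := −Σ_{i=−L}^{−1} ᾱ^{i} for L > 0 (so (1−ᾱ)·Γ = 1−ᾱ^{−L}). (Lemma 5.13.) -/
namespace Stmt14

/-- The free group of rank 2, `F₂ = ⟨α, β⟩`. -/
abbrev F2 : Type := FreeGroup (Fin 2)

/-- The generator `α`. -/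
def fα : F2 := FreeGroup.of 0

/-- The generator `β`. -/
def fβ : F2 := FreeGroup.of 1

/-- The Klein bottle relator `B = αβαβ⁻¹`. -/
def B : F2 := fα * fβ * fα * fβ⁻¹

/-- The normal closure `N = ⟪αβαβ⁻¹⟫`. -/
abbrev N : Subgroup F2 := Subgroup.normalClosure {B}

/-- The Klein bottle group `π₋ = F₂/⟪αβαβ⁻¹⟫`. -/
abbrev K := F2 ⧸ N

/-- The image `ᾱ` of `α` in `π₋`. -/
def pα : K := QuotientGroup.mk fα

/-- The image `β̄` of `β` in `π₋`. -/
def pβ : K := QuotientGroup.mk fβ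

/-- The "geometric sum" `geom x m := ∑_{i=0}^{m-1} x^i` for `m ≥ 0` and
`geom x m := -∑_{i=m}^{-1} x^i` for `m < 0`, as an element of `ℤ[G]`. -/
noncomputable def geom {G : Type} [Group G] (x : G) (m : ℤ) : MonoidAlgebra ℤ G :=
  if 0 ≤ m then ∑ i ∈ Finset.range m.toNat, MonoidAlgebra.of ℤ G (x ^ (i : ℤ))
  else -∑ i ∈ Finset.range (-m).toNat, MonoidAlgebra.of ℤ G (x ^ (m + (i : ℤ)))

/-- The alternating "geometric sum" `altGeom x m := ∑_{i=0}^{m-1} (-1)^i x^i` for `m ≥ 0`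
and `altGeom x m := ∑_{j=1}^{-m} (-1)^{j+1} x^{-j}` for `m < 0`, as an element of `ℤ[G]`. -/
noncomputable def altGeom {G : Type} [Group G] (x : G) (m : ℤ) : MonoidAlgebra ℤ G :=
  if 0 ≤ m then
    ∑ i ∈ Finset.range m.toNat, ((-1 : ℤ) ^ i) • MonoidAlgebra.of ℤ G (x ^ (i : ℤ))
  else
    ∑ i ∈ Finset.range (-m).toNat, ((-1 : ℤ) ^ i) • MonoidAlgebra.of ℤ G (x ^ (-(i : ℤ) - 1))

theorem geom_zero {G : Type} [Group G] (x : G) : geom x 0 = 0 := by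
  simp [geom]

theorem geom_add_one {G : Type} [Group G] (x : G) (m : ℤ) :
    geom x (m + 1) = geom x m + MonoidAlgebra.of ℤ G (x ^ m) := by
  obtain ⟨k, rfl | rfl⟩ : ∃ k : ℕ, m = k ∨ m = -(k + 1 : ℤ) := by
    rcases le_or_gt 0 m with h | h
    · exact ⟨m.toNat, Or.inl (by omega)⟩
    · exact ⟨(-m - 1).toNat, Or.inr (by omega)⟩
  · have h : ((k : ℤ) + 1).toNat = k + 1 := by omega
    rw [geom, geom, if_pos (by omega), if_pos (by omega), h, Finset.sum_range_succ, Int.toNat_natCast]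
  · have h : (-(-((k : ℤ) + 1))).toNat = k + 1 := by omega
    have hshift : ∀ i : ℕ, -((k : ℤ) + 1) + ((i + 1 : ℕ) : ℤ) = -(k : ℤ) + i := by
      intro i; push_cast; ring
    rw [show -((k : ℤ) + 1) + 1 = -(k : ℤ) by ring]
    rw [show geom x (-((k : ℤ) + 1)) = _ from if_neg (by omega), h, Finset.sum_range_succ']
    simp only [hshift, Nat.cast_zero, add_zero]
    rcases Nat.eq_zero_or_pos k with rfl | hk
    · simp [geom]
    · rw [geom, if_neg (by omega), neg_neg, Int.toNat_natCast]
      abel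

theorem zpow_mul_mul_zpow_succ {G : Type*} [Group G] (a b : G) (n : ℤ) :
    b ^ (-(2 * (n + 1))) * (b * a) ^ (2 * (n + 1)) =
      b ^ (-(2 * n) - 1) * (a * b * a * b⁻¹) * b ^ (2 * n + 1) *
        (b ^ (-(2 * n)) * (b * a) ^ (2 * n)) := by
  rw [show 2 * (n + 1) = 1 + 1 + 2 * n by ring, zpow_add (b * a), zpow_add (b * a), zpow_one]
  generalize (b * a) ^ (2 * n) = y
  group

theorem zpow_mul_mul_zpow_eq_prod {G : Type*} [Group G] (a b : G) (k : ℕ) :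
    b ^ (-(2 * (k : ℤ))) * (b * a) ^ (2 * (k : ℤ)) =
      (List.ofFn fun j : Fin k =>
        b ^ (1 - 2 * (k : ℤ) + 2 * (j : ℤ)) * (a * b * a * b⁻¹) *
          b ^ (2 * (k : ℤ) - 2 * (j : ℤ) - 1)).prod := by
  induction k with
  | zero => simp
  | succ k ih =>
    rw [List.ofFn_succ, List.prod_cons, Nat.cast_succ, zpow_mul_mul_zpow_succ, ih]
    congr 1
    · congr 2
      · congr 1; simp; ring
      · simp; ring
    · congr 2
      funext j
      congr 2
      · congr 1; simp; ring
      · simp; ring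

theorem zpow_mul_mul_zpow_neg_eq_prod {G : Type*} [Group G] (a b : G) (k : ℕ) :
    b ^ (-(2 * (-(k : ℤ)))) * (b * a) ^ (2 * (-(k : ℤ))) =
      (List.ofFn fun i : Fin k =>
        b ^ (1 - 2 * (-(k : ℤ)) - 2 * ((i : ℤ) + 1)) * (a * b * a * b⁻¹)⁻¹ *
          b ^ (2 * (-(k : ℤ)) + 2 * ((i : ℤ) + 1) - 1)).prod := by
  induction k with
  | zero => simp
  | succ k ih =>
    have h := zpow_mul_mul_zpow_succ a b (-((k : ℤ) + 1))
    rw [show -((k : ℤ) + 1) + 1 = -(k : ℤ) by ring, ih, ← inv_mul_eq_iff_eq_mul] at h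
    rw [List.ofFn_succ, List.prod_cons, Nat.cast_succ, ← h]
    congr 1
    · rw [mul_inv_rev, mul_inv_rev, ← zpow_neg, ← zpow_neg, ← mul_assoc]
      congr 2
      · congr 1; simp; ring
      · simp; ring
    · congr 2
      funext j
      congr 2
      · congr 1; simp; ring
      · simp; ring

theorem normalClosure_hom_ext {G H : Type*} [Group G] [Group H] {s : Set G}
    {f g : Subgroup.normalClosure s →* H}
    (h : ∀ y : Subgroup.normalClosure s, (y : G) ∈ Group.conjugatesOfSet s → f y = g y) :
    f = g :=
  MonoidHom.eq_of_eqOn_dense (Subgroup.closure_closure_coe_preimage (k := Group.conjugatesOfSet s))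
    fun y hy => h y hy

theorem map_conj_of_map_conj_relator
    (qN : (N : Subgroup F2) →* Multiplicative (MonoidAlgebra ℤ K))
    (hqN : ∀ (u : F2) (hu : u * B * u⁻¹ ∈ N),
      qN ⟨u * B * u⁻¹, hu⟩ =
        Multiplicative.ofAdd (MonoidAlgebra.of ℤ K (QuotientGroup.mk u)))
    (u : F2) (x : N) (hu : u * x * u⁻¹ ∈ N) :
    (qN ⟨u * x * u⁻¹, hu⟩).toAdd =
      MonoidAlgebra.of ℤ K (QuotientGroup.mk u) * (qN x).toAdd := by
  have hN : N.Normal := inferInstance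
  let l : N →* Multiplicative (MonoidAlgebra ℤ K) :=
    qN.comp (MulAut.conjNormal u : N ≃* N).toMonoidHom
  let r : N →* Multiplicative (MonoidAlgebra ℤ K) :=
    (AddMonoidHom.toMultiplicative
      (AddMonoidHom.mulLeft (MonoidAlgebra.of ℤ K (QuotientGroup.mk u)))).comp qN
  have hlr : l = r := by
    refine normalClosure_hom_ext fun y hy => ?_
    obtain ⟨b, rfl, hc⟩ := Group.mem_conjugatesOfSet_iff.1 hy
    obtain ⟨v, hv⟩ := isConj_iff.1 hc
    obtain ⟨y, hyN⟩ := y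
    obtain rfl : v * B * v⁻¹ = y := hv
    have huv : u * (v * B * v⁻¹) * u⁻¹ = u * v * B * (u * v)⁻¹ := by group
    have hl : l ⟨v * B * v⁻¹, hyN⟩ = qN ⟨u * v * B * (u * v)⁻¹, huv ▸ hN.conj_mem _ hyN u⟩ :=
      congrArg qN (Subtype.ext huv)
    have hr : r ⟨v * B * v⁻¹, hyN⟩ = Multiplicative.ofAdd
        (MonoidAlgebra.of ℤ K (QuotientGroup.mk u) * (qN ⟨v * B * v⁻¹, hyN⟩).toAdd) := rfl
    rw [hl, hr, hqN, hqN, toAdd_ofAdd, ← map_mul, QuotientGroup.mk_mul]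
  exact congrArg Multiplicative.toAdd (DFunLike.congr_fun hlr x)

theorem forall_int_of_iff_succ {p : ℤ → Prop} (h0 : p 0) (h : ∀ m, p m ↔ p (m + 1)) (m : ℤ) :
    p m := by
  induction m using Int.induction_on with
  | zero => exact h0
  | succ i ih => exact (h _).1 ih
  | pred i ih => exact (h _).2 (by simpa using ih)

/-- If `y = z * x` with `z ∈ N`, then `x ∈ N` with image `c` if and only if `y ∈ N` with image
`qN z + c`. -/
theorem exists_map_eq_iff (qN : (N : Subgroup F2) →* Multiplicative (MonoidAlgebra ℤ K))
    {x y : F2} (z : N) (hy : y = z * x) {c d : MonoidAlgebra ℤ K}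
    (hd : d = (qN z).toAdd + c) :
    (∃ h : x ∈ N, (qN ⟨x, h⟩).toAdd = c) ↔ ∃ h : y ∈ N, (qN ⟨y, h⟩).toAdd = d := by
  subst hy hd
  have key : ∀ (hx : x ∈ N) (hzx : z * x ∈ N),
      (qN ⟨z * x, hzx⟩).toAdd = (qN z).toAdd + (qN ⟨x, hx⟩).toAdd := fun hx _ =>
    congrArg Multiplicative.toAdd (map_mul qN z ⟨x, hx⟩)
  constructor
  · rintro ⟨hx, rfl⟩
    exact ⟨mul_mem z.2 hx, key hx _⟩
  · rintro ⟨hzx, h⟩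
    have hx : x ∈ N := (Subgroup.mul_mem_cancel_left N z.2).1 hzx
    exact ⟨hx, add_left_cancel ((key hx hzx).symm.trans h)⟩

theorem exists_map_zpow_mul_conj_zpow_eq
    (qN : (N : Subgroup F2) →* Multiplicative (MonoidAlgebra ℤ K))
    (hqN : ∀ (u : F2) (hu : u * B * u⁻¹ ∈ N),
      qN ⟨u * B * u⁻¹, hu⟩ =
        Multiplicative.ofAdd (MonoidAlgebra.of ℤ K (QuotientGroup.mk u))) (m : ℤ) :
    ∃ h : fα ^ m * fβ * fα ^ m * fβ⁻¹ ∈ N, (qN ⟨_, h⟩).toAdd = geom pα m := by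
  have hN : N.Normal := inferInstance
  induction m using forall_int_of_iff_succ with
  | h0 =>
    have h1 : fα ^ (0 : ℤ) * fβ * fα ^ (0 : ℤ) * fβ⁻¹ = 1 := by group
    rw [geom_zero]
    simp only [h1]
    exact ⟨one_mem N, congrArg Multiplicative.toAdd (map_one qN)⟩
  | h m =>
    refine exists_map_eq_iff qN
      ⟨fα ^ m * B * (fα ^ m)⁻¹, hN.conj_mem _ (Subgroup.subset_normalClosure rfl) _⟩ ?_ ?_
    · simp only [B]
      group
    · rw [hqN, geom_add_one, toAdd_ofAdd, add_comm]
      rfl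

theorem exists_map_zpow_mul_mul_zpow_eq
    (qN : (N : Subgroup F2) →* Multiplicative (MonoidAlgebra ℤ K))
    (hqN : ∀ (u : F2) (hu : u * B * u⁻¹ ∈ N),
      qN ⟨u * B * u⁻¹, hu⟩ =
        Multiplicative.ofAdd (MonoidAlgebra.of ℤ K (QuotientGroup.mk u))) (m n : ℤ) :
    ∃ h : fβ ^ (-(2 * n)) * (fβ * fα ^ m) ^ (2 * n) ∈ N, (qN ⟨_, h⟩).toAdd =
      -(MonoidAlgebra.of ℤ K pβ * geom (pβ ^ 2) (-n) * geom pα m) := by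
  have hN : N.Normal := inferInstance
  obtain ⟨hW, hqW⟩ := exists_map_zpow_mul_conj_zpow_eq qN hqN m
  induction n using forall_int_of_iff_succ with
  | h0 =>
    simp only [neg_zero, geom_zero, mul_zero, zero_mul, zpow_zero, mul_one]
    exact ⟨one_mem N, congrArg Multiplicative.toAdd (map_one qN)⟩
  | h n =>
    refine exists_map_eq_iff qN
      ⟨fβ ^ (-(2 * n) - 1) * (fα ^ m * fβ * fα ^ m * fβ⁻¹) * (fβ ^ (-(2 * n) - 1))⁻¹,
        hN.conj_mem _ hW _⟩ ?_ ?_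
    · rw [zpow_mul_mul_zpow_succ, show 2 * n + 1 = -(-(2 * n) - 1) by ring, zpow_neg]
    · have hg := geom_add_one (pβ ^ 2) (-(n + 1))
      rw [show -(n + 1) + 1 = -n by ring] at hg
      have hpow : MonoidAlgebra.of ℤ K (QuotientGroup.mk (fβ ^ (-(2 * n) - 1))) =
          MonoidAlgebra.of ℤ K pβ * MonoidAlgebra.of ℤ K ((pβ ^ 2) ^ (-(n + 1))) := by
        rw [← map_mul, QuotientGroup.mk_zpow, ← zpow_natCast, ← zpow_mul, ← zpow_one_add]
        congr 2
        push_cast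
        ring
      rw [map_conj_of_map_conj_relator qN hqN _ ⟨_, hW⟩, hqW, hg, hpow]
      noncomm_ring

/-- **Lemma 5.13.**
Let `n ∈ ℤ∖{0}`, `L ∈ ℤ`, `c_L = βα^{-L}` and `B = αβαβ⁻¹`.  Then
`β^{-2n} c_L^{2n}` equals the indicated product of conjugates of
`α^{-L}βα^{-L}β⁻¹` (respectively of its inverse, for `n < 0`); in particular it lies in
`N = ⟪B⟫`, and the homomorphism `q_N : N → (ℤ[π₋],+)` determined by `q_N(uBu⁻¹) = ū`
sends it to `-β̄·Λ·Γ`, where `Λ = geom (β̄²) (-n)` (so `(1-β̄²)·Λ = 1-β̄^{-2n}`) and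
`Γ = geom ᾱ (-L)` (so `(1-ᾱ)·Γ = 1-ᾱ^{-L}`). -/
theorem statement (n : ℤ) (hn : n ≠ 0) (L : ℤ)
    (qN : (N : Subgroup F2) →* Multiplicative (MonoidAlgebra ℤ K))
    (hqN : ∀ (u : F2) (hu : u * B * u⁻¹ ∈ N),
      qN ⟨u * B * u⁻¹, hu⟩ =
        Multiplicative.ofAdd (MonoidAlgebra.of ℤ K (QuotientGroup.mk u))) :
    (0 < n → fβ ^ (-(2 * n)) * (fβ * fα ^ (-L)) ^ (2 * n) =
      (List.ofFn fun j : Fin n.toNat =>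
        fβ ^ (1 - 2 * n + 2 * (j : ℤ)) * (fα ^ (-L) * fβ * fα ^ (-L) * fβ⁻¹) *
          fβ ^ (2 * n - 2 * (j : ℤ) - 1)).prod) ∧
    (n < 0 → fβ ^ (-(2 * n)) * (fβ * fα ^ (-L)) ^ (2 * n) =
      (List.ofFn fun i : Fin (-n).toNat =>
        fβ ^ (1 - 2 * n - 2 * ((i : ℤ) + 1)) * (fα ^ (-L) * fβ * fα ^ (-L) * fβ⁻¹)⁻¹ *
          fβ ^ (2 * n + 2 * ((i : ℤ) + 1) - 1)).prod) ∧
    ∃ hmem : fβ ^ (-(2 * n)) * (fβ * fα ^ (-L)) ^ (2 * n) ∈ N,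
      qN ⟨fβ ^ (-(2 * n)) * (fβ * fα ^ (-L)) ^ (2 * n), hmem⟩ =
        Multiplicative.ofAdd
          (-(MonoidAlgebra.of ℤ K pβ * geom (pβ ^ 2) (-n) * geom pα (-L))) := by
  refine ⟨fun h => ?_, fun h => ?_, ?_⟩
  · lift n to ℕ using h.le
    exact zpow_mul_mul_zpow_eq_prod _ _ n
  · obtain ⟨k, rfl⟩ : ∃ k : ℕ, n = -(k : ℤ) := ⟨(-n).toNat, by omega⟩
    rw [zpow_mul_mul_zpow_neg_eq_prod, neg_neg, Int.toNat_natCast]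
  · exact exists_map_zpow_mul_mul_zpow_eq qN hqN (-L) n

end Stmt14
end

section
/- Let π be any group, let K be the subgroup of the additive group (ℤ[π],+) generated by the element 1 ∈ π together with all elements g + g⁻¹ for g ∈ π∖{1}. For x ∈ π and m ∈ ℤ define Γ(x,m) := Σ_{i=0}^{m−1} x^{i} if m ≥ 0 and Γ(x,m) := −Σ_{i=m}^{−1} x^{i} if m < 0 (so (1−x)·Γ(x,m) = 1−x^{m}), and define Λ(x,k) := Σ_{j=0}^{k−1} x^{2j} if k ≥ 0 and Λ(x,k) := −Σ_{j=k}^{−1} x^{2j} if k < 0 (so (1−x²)·Λ(x,k) = 1−x^{2k}). Then for every x ∈ π and k ∈ ℤ: (a) Γ(x,2k)·x^{1−k} − x^{k} ∈ K; (b) Λ(x,k)·x^{1−k} ∈ K; (c) Λ(x,k)·x^{−k} − x^{−k} ∈ K. (Lemma 6.1.) -/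
namespace Stmt15

/-- The "geometric sum" `Γ(x,m) := ∑_{i=0}^{m-1} x^i` for `m ≥ 0` and
`Γ(x,m) := -∑_{i=m}^{-1} x^i` for `m < 0`, as an element of `ℤ[G]`
(so that `(1-x)·Γ(x,m) = 1-x^m`).  Note that `Λ(x,k) := ∑_{j=0}^{k-1} x^{2j}` for
`k ≥ 0`, `-∑_{j=k}^{-1} x^{2j}` for `k < 0`, is `Γ(x², k)`. -/
noncomputable def geom {G : Type*} [Group G] (x : G) (m : ℤ) : MonoidAlgebra ℤ G :=
  if 0 ≤ m then ∑ i ∈ Finset.range m.toNat, MonoidAlgebra.of ℤ G (x ^ (i : ℤ))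
  else -∑ i ∈ Finset.range (-m).toNat, MonoidAlgebra.of ℤ G (x ^ (m + (i : ℤ)))

/-- The subgroup `K` of `(ℤ[π],+)` generated by `1 ∈ π` together with all elements
`g + g⁻¹`, `g ∈ π∖{1}`. -/
noncomputable def KSub (π : Type*) [Group π] : AddSubgroup (MonoidAlgebra ℤ π) :=
  AddSubgroup.closure
    ({MonoidAlgebra.of ℤ π 1} ∪
      {a | ∃ g : π, g ≠ 1 ∧ a = MonoidAlgebra.of ℤ π g + MonoidAlgebra.of ℤ π g⁻¹})

theorem of_one_mem_KSub {π : Type*} [Group π] : MonoidAlgebra.of ℤ π 1 ∈ KSub π :=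
  AddSubgroup.subset_closure (Or.inl rfl)

theorem of_add_of_inv_mem_KSub {π : Type*} [Group π] (g : π) :
    MonoidAlgebra.of ℤ π g + MonoidAlgebra.of ℤ π g⁻¹ ∈ KSub π := by
  by_cases hg : g = 1
  · subst hg
    rw [inv_one]
    exact add_mem of_one_mem_KSub of_one_mem_KSub
  · exact AddSubgroup.subset_closure (Or.inr ⟨g, hg, rfl⟩)

/-- A sum of powers of `x` whose exponents form an arithmetic progression symmetric about `0`
lies in `K`. -/
theorem sum_zpow_mem_KSub {π : Type*} [Group π] (x : π) (d : ℤ) (n : ℕ) (a : ℤ)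
    (h : 2 * a + d * (n - 1) = 0) :
    ∑ i ∈ Finset.range n, MonoidAlgebra.of ℤ π (x ^ (a + d * (i : ℤ))) ∈ KSub π := by
  induction n using Nat.twoStepInduction generalizing a with
  | zero => simp
  | one =>
    obtain rfl : a = 0 := by simpa using h
    simpa using of_one_mem_KSub (π := π)
  | more n ih _ =>
    push_cast at h
    rw [Finset.sum_range_succ, Finset.sum_range_succ', add_assoc]
    refine add_mem ?_ ?_
    · convert ih (a + d) (by linear_combination h) using 4 with i
      push_cast
      ring
    · convert of_add_of_inv_mem_KSub (x ^ a) using 3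
      · simp
      · rw [← zpow_neg]
        congr 1
        push_cast
        linear_combination h

theorem geom_natCast_mul_of {π : Type*} [Group π] (x : π) (s n : ℕ) (e : ℤ) :
    geom (x ^ s) (n : ℤ) * MonoidAlgebra.of ℤ π (x ^ e) =
      ∑ i ∈ Finset.range n, MonoidAlgebra.of ℤ π (x ^ (e + s * (i : ℤ))) := by
  rw [geom, if_pos (Int.natCast_nonneg n), Int.toNat_natCast, Finset.sum_mul]
  refine Finset.sum_congr rfl fun i _ => ?_
  rw [← map_mul, ← zpow_natCast x s, ← zpow_mul, ← zpow_add, add_comm]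

theorem geom_neg_natCast_mul_of {π : Type*} [Group π] (x : π) (s n : ℕ) (e : ℤ) :
    geom (x ^ s) (-(n : ℤ)) * MonoidAlgebra.of ℤ π (x ^ e) =
      -∑ i ∈ Finset.range n, MonoidAlgebra.of ℤ π (x ^ (e - s * n + s * (i : ℤ))) := by
  obtain rfl | hn := n.eq_zero_or_pos
  · simp [geom]
  rw [geom, if_neg (by omega), neg_neg, Int.toNat_natCast, neg_mul, Finset.sum_mul]
  refine congrArg _ (Finset.sum_congr rfl fun i _ => ?_)
  rw [← map_mul, ← zpow_natCast x s, ← zpow_mul, ← zpow_add]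
  congr 2
  ring

theorem geom_two_mul_mul_sub_mem_KSub {π : Type*} [Group π] (x : π) (k : ℤ) :
    geom x (2 * k) * MonoidAlgebra.of ℤ π (x ^ (1 - k)) -
      MonoidAlgebra.of ℤ π (x ^ k) ∈ KSub π := by
  obtain ⟨n, rfl⟩ | ⟨n, rfl⟩ : (∃ n : ℕ, k = n + 1) ∨ ∃ n : ℕ, k = -n := by
    obtain hk | hk := lt_or_ge 0 k
    · exact Or.inl ⟨(k - 1).toNat, by omega⟩
    · exact Or.inr ⟨(-k).toNat, by omega⟩
  · have h := geom_natCast_mul_of x 1 (2 * n + 1 + 1) (1 - (n + 1))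
    rw [pow_one, Finset.sum_range_succ] at h
    convert sum_zpow_mem_KSub x 1 (2 * n + 1) (-n) (by push_cast; ring) using 1
    rw [show (2 * (n + 1) : ℤ) = ((2 * n + 1 + 1 : ℕ) : ℤ) by push_cast; ring, h,
      sub_eq_iff_eq_add]
    congr 3
    · funext i
      congr 2
      push_cast
      ring
    · push_cast
      ring
  · have h := geom_neg_natCast_mul_of x 1 (2 * n) (1 - -n)
    rw [pow_one] at h
    convert neg_mem (sum_zpow_mem_KSub x 1 (2 * n + 1) (-n) (by push_cast; ring)) using 1
    rw [show (2 * -n : ℤ) = -((2 * n : ℕ) : ℤ) by push_cast; ring, h, Finset.sum_range_succ',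
      neg_add, ← sub_eq_add_neg]
    congr 2
    · refine Finset.sum_congr rfl fun i _ => ?_
      congr 2
      push_cast
      ring
    · simp

theorem geom_sq_mul_mem_KSub {π : Type*} [Group π] (x : π) (k : ℤ) :
    geom (x ^ 2) k * MonoidAlgebra.of ℤ π (x ^ (1 - k)) ∈ KSub π := by
  obtain ⟨n, rfl | rfl⟩ := k.eq_nat_or_neg
  · rw [geom_natCast_mul_of]
    exact sum_zpow_mem_KSub x _ n _ (by push_cast; ring)
  · rw [geom_neg_natCast_mul_of]
    exact neg_mem (sum_zpow_mem_KSub x _ n _ (by push_cast; ring))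

theorem geom_sq_mul_sub_mem_KSub {π : Type*} [Group π] (x : π) (k : ℤ) :
    geom (x ^ 2) k * MonoidAlgebra.of ℤ π (x ^ (-k)) -
      MonoidAlgebra.of ℤ π (x ^ (-k)) ∈ KSub π := by
  obtain ⟨n, rfl⟩ | ⟨n, rfl⟩ : (∃ n : ℕ, k = (n + 1 : ℕ)) ∨ ∃ n : ℕ, k = -n := by
    obtain hk | hk := lt_or_ge 0 k
    · exact Or.inl ⟨(k - 1).toNat, by omega⟩
    · exact Or.inr ⟨(-k).toNat, by omega⟩
  · convert sum_zpow_mem_KSub x 2 n (1 - n) (by ring) using 1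
    rw [geom_natCast_mul_of, Finset.sum_range_succ', sub_eq_iff_eq_add]
    congr 1
    · refine Finset.sum_congr rfl fun i _ => ?_
      congr 2
      push_cast
      ring
  · convert neg_mem (sum_zpow_mem_KSub x 2 (n + 1) (-n) (by push_cast; ring)) using 1
    rw [geom_neg_natCast_mul_of, Finset.sum_range_succ, neg_add, ← sub_eq_add_neg]
    congr 2
    · refine Finset.sum_congr rfl fun i _ => ?_
      congr 2
      push_cast
      ring
    · congr 2
      ring

/-- **Lemma 6.1.**
Let `π` be any group and `K ⊆ (ℤ[π],+)` the subgroup generated by `1` and the elements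
`g + g⁻¹`, `g ≠ 1`.  With `Γ(x,m) = geom x m` and `Λ(x,k) = geom x² k`, for every
`x ∈ π` and `k ∈ ℤ`:
(a) `Γ(x,2k)·x^{1-k} - x^k ∈ K`;
(b) `Λ(x,k)·x^{1-k} ∈ K`;
(c) `Λ(x,k)·x^{-k} - x^{-k} ∈ K`. -/
theorem statement (π : Type*) [Group π] (x : π) (k : ℤ) :
    (geom x (2 * k) * MonoidAlgebra.of ℤ π (x ^ (1 - k)) -
        MonoidAlgebra.of ℤ π (x ^ k) ∈ KSub π) ∧
    (geom (x ^ 2) k * MonoidAlgebra.of ℤ π (x ^ (1 - k)) ∈ KSub π) ∧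
    (geom (x ^ 2) k * MonoidAlgebra.of ℤ π (x ^ (-k)) -
        MonoidAlgebra.of ℤ π (x ^ (-k)) ∈ KSub π) := by
  exact ⟨geom_two_mul_mul_sub_mem_KSub x k, geom_sq_mul_mem_KSub x k,
    geom_sq_mul_sub_mem_KSub x k⟩

end Stmt15
end

section
/- Let ε ∈ {1,−1}, π = π_ε, and ū ∈ π with w_ε(ū) = 1 (for ε = 1 this condition is vacuous). Let Ĝ be the group of bijections of π generated by g ↦ ū·g and g ↦ g⁻¹, and for h ∈ π let Ô_h denote the Ĝ-orbit of h. (A) If ε = 1 and ū = ᾱ^{m}β̄^{n}, then for h = ᾱ^{p}β̄^{q}: Ô_h = {ū^{k}·h^{±1} : k ∈ ℤ} = {ᾱ^{p+km}β̄^{q+kn} : k ∈ ℤ} ∪ {ᾱ^{−p+km}β̄^{−q+kn} : k ∈ ℤ}. (B) If ε = −1 and ū = ᾱ^{m}β̄^{2n}: for h with w₋(h) = 1, say h = ᾱ^{p}β̄^{2q}, one has Ô_h = {ū^{k}·h^{±1} : k ∈ ℤ} = {ᾱ^{p+km}β̄^{2q+2kn} : k ∈ ℤ} ∪ {ᾱ^{−p+km}β̄^{−2q+2kn}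 : k ∈ ℤ}; for h with w₋(h) = −1, say h = ᾱ^{p}β̄^{2q+1}, one has Ô_h = {ᾱ^{p+km}β̄^{2q+1+(2k+4r)n} : k,r ∈ ℤ} ∪ {ᾱ^{p+km}β̄^{−(2q+1)+(2k+4r)n} : k,r ∈ ℤ}; moreover the set of orbits of elements h with w₋(h) = −1 is in bijection with ℤ_{|m|} ⊕ ℤ_{|n|} (where ℤ_0 := ℤ and ℤ_1 := {0}); in particular the number of such orbits equals |mn| if mn ≠ 0 and is infinite if mn = 0. (Proposition 6.5.) -/
namespace Stmt17

/-- The free group of rank 2, `F₂ = ⟨α, β⟩`. -/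
abbrev F2 : Type := FreeGroup (Fin 2)

/-- The generator `α`. -/
def fα : F2 := FreeGroup.of 0

/-- The generator `β`. -/
def fβ : F2 := FreeGroup.of 1

/-- The relator `B = αβα^{-ε}β⁻¹`. -/
def B (ε : ℤˣ) : F2 := fα * fβ * fα ^ (-(ε : ℤ)) * fβ⁻¹

/-- The surface group `π_ε = F₂/⟪αβα^{-ε}β⁻¹⟫` (the free abelian group of rank 2 for
`ε = 1`, the Klein bottle group for `ε = -1`). -/
abbrev piQ (ε : ℤˣ) := F2 ⧸ Subgroup.normalClosure {B ε}

/-- The image `ᾱ` of `α` in `π_ε`. -/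
def pα (ε : ℤˣ) : piQ ε := QuotientGroup.mk fα

/-- The image `β̄` of `β` in `π_ε`. -/
def pβ (ε : ℤˣ) : piQ ε := QuotientGroup.mk fβ

/-- The group `Ĝ` of bijections of `π_ε` generated by `g ↦ ū·g` and `g ↦ g⁻¹`. -/
noncomputable def Ghat (ε : ℤˣ) (u : piQ ε) : Subgroup (Equiv.Perm (piQ ε)) :=
  Subgroup.closure {Equiv.mulLeft u, Equiv.inv (piQ ε)}

/-- The orbit of `h` under a subgroup `H` of the permutation group. -/
def Orb {X : Type} (H : Subgroup (Equiv.Perm X)) (h : X) : Set X :=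
  {g | ∃ σ ∈ H, σ h = g}

section Orbits

variable {ε : ℤˣ} {u : piQ ε}

theorem self_mem_Orb (h : piQ ε) : h ∈ Orb (Ghat ε u) h :=
  ⟨1, one_mem _, rfl⟩

theorem apply_mem_Orb {σ : Equiv.Perm (piQ ε)} (hσ : σ ∈ Ghat ε u) {g h : piQ ε}
    (hg : g ∈ Orb (Ghat ε u) h) : σ g ∈ Orb (Ghat ε u) h := by
  obtain ⟨τ, hτ, rfl⟩ := hg
  exact ⟨σ * τ, mul_mem hσ hτ, rfl⟩

theorem inv_mem_Orb {g h : piQ ε} (hg : g ∈ Orb (Ghat ε u) h) : g⁻¹ ∈ Orb (Ghat ε u) h :=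
  apply_mem_Orb (σ := Equiv.inv (piQ ε)) (Subgroup.subset_closure (by simp)) hg

theorem mulLeft_mem_Ghat : Equiv.mulLeft u ∈ Ghat ε u :=
  Subgroup.subset_closure (by simp)

theorem zpow_mul_mem_Orb (k : ℤ) {g h : piQ ε} (hg : g ∈ Orb (Ghat ε u) h) :
    u ^ k * g ∈ Orb (Ghat ε u) h := by
  have := apply_mem_Orb (zpow_mem (mulLeft_mem_Ghat (u := u)) k) hg
  rwa [Equiv.zpow_mulLeft] at this

theorem Orb_subset {S : Set (piQ ε)} {h : piQ ε} (hh : h ∈ S)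
    (hmul : ∀ k : ℤ, ∀ g ∈ S, u ^ k * g ∈ S) (hinv : ∀ g ∈ S, g⁻¹ ∈ S) :
    Orb (Ghat ε u) h ⊆ S := by
  rintro _ ⟨σ, hσ, rfl⟩
  suffices H : ∀ g ∈ S, σ g ∈ S ∧ σ⁻¹ g ∈ S from (H h hh).1
  refine Subgroup.closure_induction
    (p := fun σ _ => ∀ g ∈ S, σ g ∈ S ∧ σ⁻¹ g ∈ S) ?_ ?_ ?_ ?_ hσ
  · rintro τ (rfl | rfl) g hg
    · have h1 := hmul 1 g hg
      have h2 := hmul (-1) g hg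
      rw [zpow_one] at h1
      rw [zpow_neg_one] at h2
      exact ⟨h1, h2⟩
    · exact ⟨hinv g hg, hinv g hg⟩
  · exact fun g hg => ⟨hg, hg⟩
  · intro x y _ _ hx hy g hg
    refine ⟨(hx _ (hy g hg).1).1, ?_⟩
    rw [mul_inv_rev]
    exact (hy _ (hx g hg).2).2
  · intro x _ hx g hg
    rw [inv_inv]
    exact (hx g hg).symm

theorem Orb_eq_of_mem {g h : piQ ε} (hg : g ∈ Orb (Ghat ε u) h) :
    Orb (Ghat ε u) g = Orb (Ghat ε u) h := by
  obtain ⟨σ, hσ, rfl⟩ := hg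
  refine Set.Subset.antisymm ?_ ?_
  · rintro _ ⟨τ, hτ, rfl⟩
    exact ⟨τ * σ, mul_mem hτ hσ, rfl⟩
  · rintro _ ⟨τ, hτ, rfl⟩
    exact ⟨τ * σ⁻¹, mul_mem hτ (inv_mem hσ), by simp⟩

theorem Orb_eq_of_commute {h : piQ ε} (huh : Commute u h) :
    Orb (Ghat ε u) h = {x | ∃ k : ℤ, x = u ^ k * h ∨ x = u ^ k * h⁻¹} := by
  refine Set.Subset.antisymm (Orb_subset ⟨0, by simp⟩ ?_ ?_) ?_
  · rintro j _ ⟨k, rfl | rfl⟩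
    · exact ⟨j + k, Or.inl (by rw [zpow_add, mul_assoc])⟩
    · exact ⟨j + k, Or.inr (by rw [zpow_add, mul_assoc])⟩
  · rintro _ ⟨k, rfl | rfl⟩
    · exact ⟨-k, Or.inr (by rw [(huh.zpow_left k).eq, mul_inv_rev, zpow_neg])⟩
    · exact ⟨-k, Or.inl (by rw [(huh.inv_right.zpow_left k).eq, mul_inv_rev, zpow_neg, inv_inv])⟩
  · rintro _ ⟨k, rfl | rfl⟩
    · exact zpow_mul_mem_Orb k (self_mem_Orb h)
    · exact zpow_mul_mem_Orb k (inv_mem_Orb (self_mem_Orb h))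

theorem zpow_mul_zpow_mul_zpow {G : Type*} [Group G] {a c : G} (hac : Commute a c)
    (m n p q k : ℤ) :
    (a ^ m * c ^ n) ^ k * (a ^ p * c ^ q) = a ^ (p + k * m) * c ^ (q + k * n) := by
  rw [(hac.zpow_zpow m n).mul_zpow, ← zpow_mul, ← zpow_mul,
    ((hac.zpow_zpow p (n * k)).symm).mul_mul_mul_comm, ← zpow_add, ← zpow_add]
  ring_nf

theorem Orb_eq_union_of_commute {a c : piQ ε} (hac : Commute a c) {m n : ℤ}
    (hu : u = a ^ m * c ^ n) (p q : ℤ) :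
    Orb (Ghat ε u) (a ^ p * c ^ q) =
        {x | ∃ k : ℤ, x = u ^ k * (a ^ p * c ^ q) ∨ x = u ^ k * (a ^ p * c ^ q)⁻¹} ∧
      Orb (Ghat ε u) (a ^ p * c ^ q) =
        {x | ∃ k : ℤ, x = a ^ (p + k * m) * c ^ (q + k * n)} ∪
          {x | ∃ k : ℤ, x = a ^ (-p + k * m) * c ^ (-q + k * n)} := by
  have huh : Commute u (a ^ p * c ^ q) := by
    rw [hu]
    exact (((Commute.refl a).zpow_zpow m p).mul_right (hac.zpow_zpow m q)).mul_left
      ((hac.symm.zpow_zpow n p).mul_right ((Commute.refl c).zpow_zpow n q))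
  refine ⟨Orb_eq_of_commute huh, ?_⟩
  have hinv : (a ^ p * c ^ q)⁻¹ = a ^ (-p) * c ^ (-q) := by
    rw [(hac.zpow_zpow p q).mul_inv, zpow_neg, zpow_neg]
  rw [Orb_eq_of_commute huh, hinv, hu]
  ext x
  simp only [zpow_mul_zpow_mul_zpow hac, Set.mem_ofPred_eq, Set.mem_union, exists_or]

end Orbits

section Klein

variable {G : Type*} [Group G] {a b : G}

theorem commute_sq_of_mul_eq (hab : b * a = a⁻¹ * b) : Commute a (b ^ (2 : ℤ)) := by
  have h : SemiconjBy b a a⁻¹ := hab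
  have h2 := h.inv_right.mul_left h
  rw [inv_inv] at h2
  rw [zpow_two]
  exact Commute.symm h2

theorem commute_zpow_two_mul (hab : b * a = a⁻¹ * b) (p q : ℤ) :
    Commute (a ^ p) (b ^ (2 * q)) := by
  rw [zpow_mul]
  exact (commute_sq_of_mul_eq hab).zpow_zpow p q

theorem zpow_mul_zpow_even_mul (hab : b * a = a⁻¹ * b) (m n p s : ℤ) :
    a ^ m * b ^ (2 * n) * (a ^ p * b ^ s) = a ^ (m + p) * b ^ (2 * n + s) := by
  rw [(commute_zpow_two_mul hab p n).symm.mul_mul_mul_comm, ← zpow_add, ← zpow_add]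

theorem inv_zpow_mul_zpow_odd (hab : b * a = a⁻¹ * b) (p q : ℤ) :
    (a ^ p * b ^ (2 * q + 1))⁻¹ = a ^ p * b ^ (-(2 * q + 1)) := by
  have h : SemiconjBy b a a⁻¹ := hab
  have h1 : SemiconjBy (b ^ (2 * q + 1)) (a ^ p) (a ^ (-p)) := by
    rw [zpow_add, zpow_one, zpow_neg, ← inv_zpow]
    refine SemiconjBy.mul_left ?_ (h.zpow_right p)
    rw [inv_zpow']
    exact (commute_zpow_two_mul hab (-p) q).symm
  have h2 : b ^ (2 * q + 1) * a ^ p = a ^ (-p) * b ^ (2 * q + 1) := h1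
  rw [inv_eq_iff_mul_eq_one, mul_assoc, ← mul_assoc (b ^ (2 * q + 1)), h2, mul_assoc, ← zpow_add,
    add_neg_cancel, zpow_zero, mul_one, ← zpow_add, add_neg_cancel, zpow_zero]

theorem zpow_zpow_even_mul (hab : b * a = a⁻¹ * b) (m n k p s : ℤ) :
    (a ^ m * b ^ (2 * n)) ^ k * (a ^ p * b ^ s) = a ^ (p + k * m) * b ^ (s + 2 * k * n) := by
  rw [(commute_zpow_two_mul hab m n).mul_zpow, ← zpow_mul, ← zpow_mul, mul_assoc 2 n k,
    zpow_mul_zpow_even_mul hab]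
  ring_nf

end Klein

theorem Orb_eq_of_odd {ε : ℤˣ} {u a b : piQ ε} (hab : b * a = a⁻¹ * b) {m n : ℤ}
    (hu : u = a ^ m * b ^ (2 * n)) (p q : ℤ) :
    Orb (Ghat ε u) (a ^ p * b ^ (2 * q + 1)) =
      {x | ∃ k r : ℤ, x = a ^ (p + k * m) * b ^ (2 * q + 1 + (2 * k + 4 * r) * n)} ∪
        {x | ∃ k r : ℤ, x = a ^ (p + k * m) * b ^ (-(2 * q + 1) + (2 * k + 4 * r) * n)} := by
  have hmul (k p s : ℤ) : u ^ k * (a ^ p * b ^ s) = a ^ (p + k * m) * b ^ (s + 2 * k * n) := by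
    rw [hu, zpow_zpow_even_mul hab]
  have hinv {p s t : ℤ} (hs : Odd s) (ht : t = -s) : (a ^ p * b ^ s)⁻¹ = a ^ p * b ^ t := by
    obtain ⟨q, rfl⟩ := hs
    rw [inv_zpow_mul_zpow_odd hab, ht]
  have hodd (s k r : ℤ) (hs : Odd s) : Odd (s + (2 * k + 4 * r) * n) :=
    hs.add_even ⟨(k + 2 * r) * n, by ring⟩
  have hq : Odd (2 * q + 1) := odd_two_mul_add_one q
  refine Set.Subset.antisymm (Orb_subset (Or.inl ⟨0, 0, by simp⟩) ?_ ?_) ?_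
  · rintro j _ (⟨k, r, rfl⟩ | ⟨k, r, rfl⟩)
    · refine Or.inl ⟨k + j, r, ?_⟩
      rw [hmul]
      ring_nf
    · refine Or.inr ⟨k + j, r, ?_⟩
      rw [hmul]
      ring_nf
  · rintro _ (⟨k, r, rfl⟩ | ⟨k, r, rfl⟩)
    · exact Or.inr ⟨k, -k - r, hinv (hodd _ _ _ hq) (by ring)⟩
    · exact Or.inl ⟨k, -k - r, hinv (hodd _ _ _ hq.neg) (by ring)⟩
  · have shift {p s : ℤ} (hs : Odd s) (k r : ℤ) {h : piQ ε}
        (hh : a ^ p * b ^ s ∈ Orb (Ghat ε u) h) :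
        a ^ (p + k * m) * b ^ (s + (2 * k + 4 * r) * n) ∈ Orb (Ghat ε u) h := by
      have h1 := zpow_mul_mem_Orb r hh
      rw [hmul] at h1
      have h2 := inv_mem_Orb h1
      rw [hinv (hs.add_even ⟨r * n, by ring⟩) rfl] at h2
      have h3 := zpow_mul_mem_Orb (-r) h2
      rw [hmul] at h3
      have h4 := inv_mem_Orb h3
      rw [hinv ((hs.add_even ⟨r * n, by ring⟩).neg.add_even ⟨-r * n, by ring⟩) rfl] at h4
      have h5 := zpow_mul_mem_Orb k h4
      rw [hmul] at h5
      ring_nf at h5 ⊢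
      exact h5
    have h0 : a ^ p * b ^ (2 * q + 1) ∈ Orb (Ghat ε u) (a ^ p * b ^ (2 * q + 1)) :=
      self_mem_Orb _
    rintro _ (⟨k, r, rfl⟩ | ⟨k, r, rfl⟩)
    · exact shift hq k r h0
    · refine shift hq.neg k r ?_
      rw [← hinv hq rfl]
      exact inv_mem_Orb h0

section KleinGroup

theorem pβ_mul_pα (ε : ℤˣ) : pα ε * pβ ε = pβ ε * pα ε ^ (ε : ℤ) := by
  have h : (QuotientGroup.mk (B ε) : piQ ε) = 1 :=
    (QuotientGroup.eq_one_iff _).2 (Subgroup.subset_normalClosure rfl)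
  have h' : pα ε * pβ ε * pα ε ^ (-(ε : ℤ)) * (pβ ε)⁻¹ = 1 := h
  rw [mul_inv_eq_one, zpow_neg, mul_inv_eq_iff_eq_mul] at h'
  exact h'

theorem commute_pα_pβ : Commute (pα 1) (pβ 1) := by
  have h := pβ_mul_pα 1
  rwa [Units.val_one, zpow_one] at h

theorem pβ_mul_pα_neg_one : pβ (-1) * pα (-1) = (pα (-1))⁻¹ * pβ (-1) := by
  have h := pβ_mul_pα (-1)
  simp only [Units.val_neg, Units.val_one, zpow_neg, zpow_one] at h
  rw [eq_inv_mul_iff_mul_eq, ← mul_assoc, h, inv_mul_cancel_right]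

/-- The permutation of `ℤ × ℤ` by which `ᾱ` acts on canonical forms. -/
def permα : Equiv.Perm (ℤ × ℤ) where
  toFun x := (x.1 + 1, x.2)
  invFun x := (x.1 - 1, x.2)
  left_inv x := by simp
  right_inv x := by simp

/-- The permutation of `ℤ × ℤ` by which `β̄` acts on canonical forms in `π₋`. -/
def permβ : Equiv.Perm (ℤ × ℤ) where
  toFun x := (-x.1, x.2 + 1)
  invFun x := (-x.1, x.2 - 1)
  left_inv x := by simp
  right_inv x := by simp

theorem permα_zpow (p : ℤ) (x : ℤ × ℤ) : (permα ^ p) x = (x.1 + p, x.2) := by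
  induction p using Int.induction_on generalizing x with
  | zero => simp
  | succ i ih => rw [zpow_add_one, Equiv.Perm.mul_apply, ih]; simp [permα]; ring
  | pred i ih => rw [zpow_sub_one, Equiv.Perm.mul_apply, ih]; simp [permα, Equiv.Perm.inv_def]; ring

theorem permβ_zpow (s x : ℤ) : (permβ ^ s) (0, x) = (0, x + s) := by
  induction s using Int.induction_on generalizing x with
  | zero => simp
  | succ i ih =>
    rw [zpow_add_one, Equiv.Perm.mul_apply]
    simp [permβ] at ih ⊢
    rw [ih]; ring_nf
  | pred i ih =>
    rw [zpow_sub_one, Equiv.Perm.mul_apply]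
    simp [permβ, Equiv.Perm.inv_def] at ih ⊢
    rw [ih]; ring_nf

/-- The action of `π₋` on canonical forms by left multiplication. -/
noncomputable def kleinAction : piQ (-1) →* Equiv.Perm (ℤ × ℤ) :=
  QuotientGroup.lift _ (FreeGroup.lift ![permα, permβ]) (by
    refine Subgroup.normalClosure_le_normal ?_
    rintro _ rfl
    ext x <;> simp [B, fα, fβ, permα, permβ, Equiv.Perm.inv_def])

theorem kleinAction_apply (p s : ℤ) :
    kleinAction (pα (-1) ^ p * pβ (-1) ^ s) (0, 0) = (p, s) := by
  have hα : kleinAction (pα (-1)) = permα := by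
    simp [kleinAction, pα, fα]
  have hβ : kleinAction (pβ (-1)) = permβ := by
    simp [kleinAction, pβ, fβ]
  rw [map_mul, map_zpow, map_zpow, hα, hβ, Equiv.Perm.mul_apply, permβ_zpow, permα_zpow]
  simp

theorem canonical_form_inj {p s p' s' : ℤ} :
    pα (-1) ^ p * pβ (-1) ^ s = pα (-1) ^ p' * pβ (-1) ^ s' ↔ p = p' ∧ s = s' := by
  refine ⟨fun h => ?_, by rintro ⟨rfl, rfl⟩; rfl⟩
  have := congrArg (fun g => kleinAction g (0, 0)) h
  simpa only [kleinAction_apply, Prod.mk.injEq] using this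

theorem exists_canonical_form (h : piQ (-1)) :
    ∃ p s : ℤ, h = pα (-1) ^ p * pβ (-1) ^ s := by
  have hab := pβ_mul_pα_neg_one
  induction h using QuotientGroup.induction_on with | H x => ?_
  have hα (g : piQ (-1)) (k : ℤ) (hg : ∃ p s : ℤ, g = pα (-1) ^ p * pβ (-1) ^ s) :
      ∃ p s : ℤ, pα (-1) ^ k * g = pα (-1) ^ p * pβ (-1) ^ s := by
    obtain ⟨p, s, rfl⟩ := hg
    exact ⟨k + p, s, by rw [zpow_add, mul_assoc]⟩
  have hβ (g : piQ (-1)) (hg : ∃ p s : ℤ, g = pα (-1) ^ p * pβ (-1) ^ s) :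
      ∃ p s : ℤ, pβ (-1) * g = pα (-1) ^ p * pβ (-1) ^ s := by
    obtain ⟨p, s, rfl⟩ := hg
    have h : SemiconjBy (pβ (-1)) (pα (-1)) (pα (-1))⁻¹ := hab
    refine ⟨-p, 1 + s, ?_⟩
    rw [← mul_assoc, (h.zpow_right p).eq, inv_zpow', mul_assoc, zpow_add, zpow_one]
  have hβinv (g : piQ (-1)) (hg : ∃ p s : ℤ, g = pα (-1) ^ p * pβ (-1) ^ s) :
      ∃ p s : ℤ, (pβ (-1))⁻¹ * g = pα (-1) ^ p * pβ (-1) ^ s := by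
    obtain ⟨p, s, h⟩ := hβ g hg
    refine ⟨p, -2 + s, ?_⟩
    have h2 := zpow_mul_zpow_even_mul hab 0 (-1) p s
    rw [zero_add, zpow_zero, one_mul, ← h] at h2
    rw [show (-2 : ℤ) + s = 2 * -1 + s by ring, ← h2, ← mul_assoc]
    congr 1
    group
  obtain ⟨L, rfl⟩ := Quot.exists_rep x
  change ∃ p s : ℤ, (QuotientGroup.mk (FreeGroup.mk L) : piQ (-1)) = _
  induction L with
  | nil => exact ⟨0, 0, by rw [← FreeGroup.one_eq_mk]; simp⟩
  | cons y L ih =>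
    have key : (QuotientGroup.mk (FreeGroup.mk (y :: L)) : piQ (-1)) =
        QuotientGroup.mk (FreeGroup.mk [y]) * QuotientGroup.mk (FreeGroup.mk L) := by
      rw [← QuotientGroup.mk_mul, FreeGroup.mul_mk, List.singleton_append]
    rw [key]
    obtain ⟨i, e⟩ := y
    have hinv (i : Fin 2) : FreeGroup.mk [(i, false)] = (FreeGroup.of i)⁻¹ := by
      simp [FreeGroup.of, FreeGroup.invRev]
    fin_cases i <;> cases e
    · have := hα _ (-1) ih
      rw [zpow_neg_one] at this
      simpa only [hinv] using! this
    · have := hα _ 1 ih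
      rw [zpow_one] at this
      exact this
    · simpa only [hinv] using! hβinv _ ih
    · exact hβ _ ih

theorem exists_canonical_form_odd (w : piQ (-1) →* ℤˣ) (hwα : w (pα (-1)) = 1)
    (hwβ : w (pβ (-1)) = -1) (h : piQ (-1)) :
    w h = -1 ↔ ∃ p q : ℤ, h = pα (-1) ^ p * pβ (-1) ^ (2 * q + 1) := by
  constructor
  · intro hh
    obtain ⟨p, s, rfl⟩ := exists_canonical_form h
    obtain ⟨q, rfl | rfl⟩ := Int.even_or_odd' s
    · rw [map_mul, map_zpow, map_zpow, hwα, hwβ, zpow_mul] at hh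
      simp at hh
    · exact ⟨p, q, rfl⟩
  · rintro ⟨p, q, rfl⟩
    rw [map_mul, map_zpow, map_zpow, hwα, hwβ, zpow_add, zpow_mul]
    simp

end KleinGroup

section Counting

variable {u : piQ (-1)} {m n : ℤ}

theorem Orb_odd_eq_iff (hu : u = pα (-1) ^ m * pβ (-1) ^ (2 * n)) (p q p' q' : ℤ) :
    Orb (Ghat (-1) u) (pα (-1) ^ p' * pβ (-1) ^ (2 * q' + 1)) =
        Orb (Ghat (-1) u) (pα (-1) ^ p * pβ (-1) ^ (2 * q + 1)) ↔
      ∃ k r : ℤ, p' = p + k * m ∧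
        (q' = q + (k + 2 * r) * n ∨ q' = -q - 1 + (k + 2 * r) * n) := by
  trans pα (-1) ^ p' * pβ (-1) ^ (2 * q' + 1) ∈
    Orb (Ghat (-1) u) (pα (-1) ^ p * pβ (-1) ^ (2 * q + 1))
  · exact ⟨fun h => h ▸ self_mem_Orb _, Orb_eq_of_mem⟩
  rw [Orb_eq_of_odd pβ_mul_pα_neg_one hu]
  simp only [Set.mem_union, Set.mem_ofPred_eq, canonical_form_inj, ← exists_or, ← and_or_left]
  refine exists_congr fun k => exists_congr fun r => and_congr_right fun _ => or_congr ?_ ?_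
  · have : (2 * k + 4 * r) * n = 2 * ((k + 2 * r) * n) := by ring
    rw [this]
    omega
  · have : (2 * k + 4 * r) * n = 2 * ((k + 2 * r) * n) := by ring
    rw [this]
    omega

variable {w : piQ (-1) →* ℤˣ}

/-- The orbit of `ᾱ^p β̄^(2q+1)`, as an element of the set of orbits of the elements `h` with
`w h = -1`. -/
noncomputable def oddOrbit (u : piQ (-1)) (hwα : w (pα (-1)) = 1) (hwβ : w (pβ (-1)) = -1)
    (x : ℤ × ℤ) :
    {O : Set (piQ (-1)) // ∃ h, w h = -1 ∧ O = Orb (Ghat (-1) u) h} :=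
  ⟨Orb (Ghat (-1) u) (pα (-1) ^ x.1 * pβ (-1) ^ (2 * x.2 + 1)), _,
    (exists_canonical_form_odd w hwα hwβ _).2 ⟨_, _, rfl⟩, rfl⟩

theorem oddOrbit_surjective (hwα : w (pα (-1)) = 1) (hwβ : w (pβ (-1)) = -1) :
    Function.Surjective (oddOrbit u hwα hwβ) := by
  rintro ⟨_, h, hh, rfl⟩
  obtain ⟨p, q, rfl⟩ := (exists_canonical_form_odd w hwα hwβ h).1 hh
  exact ⟨(p, q), rfl⟩

theorem oddOrbit_eq_iff (hwα : w (pα (-1)) = 1) (hwβ : w (pβ (-1)) = -1)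
    (hu : u = pα (-1) ^ m * pβ (-1) ^ (2 * n)) (x y : ℤ × ℤ) :
    oddOrbit u hwα hwβ x = oddOrbit u hwα hwβ y ↔
      ∃ k r : ℤ, x.1 = y.1 + k * m ∧
        (x.2 = y.2 + (k + 2 * r) * n ∨ x.2 = -y.2 - 1 + (k + 2 * r) * n) := by
  rw [← Orb_odd_eq_iff hu]
  exact Subtype.ext_iff

theorem infinite_oddOrbits (hwα : w (pα (-1)) = 1) (hwβ : w (pβ (-1)) = -1)
    (hu : u = pα (-1) ^ m * pβ (-1) ^ (2 * n)) (hmn : m * n = 0) :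
    Infinite {O : Set (piQ (-1)) // ∃ h, w h = -1 ∧ O = Orb (Ghat (-1) u) h} := by
  rcases mul_eq_zero.1 hmn with rfl | rfl
  · refine Infinite.of_injective (fun p : ℤ => oddOrbit u hwα hwβ (p, 0)) fun p p' h => ?_
    obtain ⟨k, r, h1, -⟩ := (oddOrbit_eq_iff hwα hwβ hu _ _).1 h
    simpa using h1
  · refine Infinite.of_injective (fun q : ℕ => oddOrbit u hwα hwβ (0, (q : ℤ))) fun q q' h => ?_
    obtain ⟨k, r, -, h1⟩ := (oddOrbit_eq_iff hwα hwβ hu _ _).1 h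
    simp only [mul_zero, add_zero] at h1
    omega

theorem card_oddOrbits (hwα : w (pα (-1)) = 1) (hwβ : w (pβ (-1)) = -1)
    (hu : u = pα (-1) ^ m * pβ (-1) ^ (2 * n)) (hmn : m * n ≠ 0) :
    Nat.card {O : Set (piQ (-1)) // ∃ h, w h = -1 ∧ O = Orb (Ghat (-1) u) h} =
      (m * n).natAbs := by
  obtain ⟨hm, hn⟩ := mul_ne_zero_iff.1 hmn
  have hbij : Function.Bijective (fun x : Fin m.natAbs × Fin n.natAbs =>
      oddOrbit u hwα hwβ ((x.1 : ℤ), (x.2 : ℤ))) := by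
    constructor
    · rintro ⟨⟨i, hi⟩, ⟨j, hj⟩⟩ ⟨⟨i', hi'⟩, ⟨j', hj'⟩⟩ h
      obtain ⟨k, r, h1, h2⟩ := (oddOrbit_eq_iff hwα hwβ hu _ _).1 h
      simp only at h1 h2
      have hk : k * m = 0 :=
        Int.eq_zero_of_abs_lt_dvd (m := m.natAbs) (by simp) (by rw [abs_lt]; omega)
      obtain rfl : k = 0 := (mul_eq_zero.1 hk).resolve_right hm
      have hr : (0 + 2 * r) * n = 2 * (r * n) := by ring
      rw [hr] at h2
      have hr0 : 2 * (r * n) = 0 :=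
        Int.eq_zero_of_abs_lt_dvd (m := 2 * n.natAbs)
          (by
            refine mul_dvd_mul_left 2 ?_
            simp) (by rw [abs_lt]; omega)
      simp only [Prod.mk.injEq, Fin.mk.injEq]
      omega
    · intro O
      obtain ⟨⟨p, q⟩, rfl⟩ := oddOrbit_surjective hwα hwβ O
      have hp := Int.emod_nonneg p hm
      have hp' := Int.emod_lt p hm
      obtain ⟨t, d, ht, ht0, htn⟩ : ∃ t d : ℤ, q = t + (p / m + 2 * d) * n ∧ 0 ≤ t ∧
          t < 2 * n.natAbs := by
        refine ⟨(q - p / m * n) % (2 * n), (q - p / m * n) / (2 * n), ?_,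
          Int.emod_nonneg _ (by omega), ?_⟩
        · have := Int.emod_add_mul_ediv (q - p / m * n) (2 * n)
          linear_combination -this
        · have := Int.emod_lt (q - p / m * n) (b := 2 * n) (by omega)
          omega
      have hpm : p = p % m + p / m * m := by
        have := Int.emod_add_mul_ediv p m
        linear_combination -this
      by_cases hlt : t < n.natAbs
      · refine ⟨(⟨(p % m).toNat, by omega⟩, ⟨t.toNat, by omega⟩), ?_⟩
        refine Eq.symm ((oddOrbit_eq_iff hwα hwβ hu _ _).2 ⟨p / m, d, ?_, Or.inl ?_⟩)
        · simpa [hp] using hpm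
        · simpa [ht0] using ht
      · have hs : ((2 * n.natAbs - 1 - t).toNat : ℤ) = 2 * |n| - 1 - t := by
          rw [← Int.natCast_natAbs]
          omega
        refine ⟨(⟨(p % m).toNat, by omega⟩, ⟨(2 * n.natAbs - 1 - t).toNat, by omega⟩), ?_⟩
        refine Eq.symm ((oddOrbit_eq_iff hwα hwβ hu _ _).2
          ⟨p / m, d + n.sign, ?_, Or.inr ?_⟩)
        · simpa [hp] using hpm
        · simp only [hs]
          have := Int.sign_mul_self_eq_abs n
          linear_combination ht - 2 * this
  rw [← Nat.card_eq_of_bijective _ hbij]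
  simp [Int.natAbs_mul]

theorem nonempty_oddOrbits_equiv (hwα : w (pα (-1)) = 1) (hwβ : w (pβ (-1)) = -1)
    (hu : u = pα (-1) ^ m * pβ (-1) ^ (2 * n)) :
    Nonempty ({O : Set (piQ (-1)) // ∃ h, w h = -1 ∧ O = Orb (Ghat (-1) u) h} ≃
      (ZMod m.natAbs × ZMod n.natAbs)) := by
  by_cases hmn : m * n = 0
  · have := infinite_oddOrbits hwα hwβ hu hmn
    have := (oddOrbit_surjective (u := u) hwα hwβ).countable
    have hcount (k : ℕ) : Countable (ZMod k) := (ZMod.intCast_surjective (n := k)).countable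
    have : Infinite (ZMod m.natAbs × ZMod n.natAbs) := by
      rcases mul_eq_zero.1 hmn with rfl | rfl
      · exact Prod.infinite_of_left (α := ℤ)
      · exact Prod.infinite_of_right (β := ℤ)
    exact nonempty_equiv_of_countable
  · have hc := card_oddOrbits hwα hwβ hu hmn
    have : Finite {O : Set (piQ (-1)) // ∃ h, w h = -1 ∧ O = Orb (Ghat (-1) u) h} :=
      Nat.finite_of_card_ne_zero (by rw [hc]; simpa using hmn)
    obtain ⟨hm, hn⟩ := mul_ne_zero_iff.1 hmn
    have : NeZero m.natAbs := ⟨by simpa using hm⟩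
    have : NeZero n.natAbs := ⟨by simpa using hn⟩
    refine ⟨(Finite.equivFinOfCardEq hc).trans (Finite.equivFinOfCardEq ?_).symm⟩
    rw [Nat.card_prod, Nat.card_zmod, Nat.card_zmod, Int.natAbs_mul]

end Counting

/-- **Proposition 6.5.**
Description of the orbits `Ô_h` of the group `Ĝ` generated by `g ↦ ū·g` and `g ↦ g⁻¹`
acting on `π_ε`, where `w_ε(ū) = 1`:
(A) for `ε = 1` and `ū = ᾱ^m β̄^n`, `h = ᾱ^p β̄^q`, one has
`Ô_h = {ū^k h^{±1}} = {ᾱ^{p+km}β̄^{q+kn}} ∪ {ᾱ^{-p+km}β̄^{-q+kn}}`;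
(B) for `ε = -1` and `ū = ᾱ^m β̄^{2n}`: if `w₋(h) = 1`, `h = ᾱ^p β̄^{2q}`, then
`Ô_h = {ū^k h^{±1}} = {ᾱ^{p+km}β̄^{2q+2kn}} ∪ {ᾱ^{-p+km}β̄^{-2q+2kn}}`; if
`w₋(h) = -1`, `h = ᾱ^p β̄^{2q+1}`, then
`Ô_h = {ᾱ^{km}β̄^{(2k+4r)n} h^{±1}}
     = {ᾱ^{p+km}β̄^{2q+1+(2k+4r)n}} ∪ {ᾱ^{p+km}β̄^{-(2q+1)+(2k+4r)n}}`;
moreover the set of orbits of elements `h` with `w₋(h) = -1` is in bijection with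
`ℤ_{|m|} ⊕ ℤ_{|n|}`; in particular the number of such orbits is `|mn|` if `mn ≠ 0`
and is infinite if `mn = 0`. -/
theorem statement (ε : ℤˣ) (u : piQ ε) (w : piQ ε →* ℤˣ)
    (hwα : w (pα ε) = 1) (hwβ : w (pβ ε) = ε) (hu : w u = 1) :
    (ε = 1 → ∀ m n p q : ℤ, u = pα ε ^ m * pβ ε ^ n →
      (Orb (Ghat ε u) (pα ε ^ p * pβ ε ^ q) =
          {x | ∃ k : ℤ, x = u ^ k * (pα ε ^ p * pβ ε ^ q) ∨
            x = u ^ k * (pα ε ^ p * pβ ε ^ q)⁻¹} ∧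
        Orb (Ghat ε u) (pα ε ^ p * pβ ε ^ q) =
          {x | ∃ k : ℤ, x = pα ε ^ (p + k * m) * pβ ε ^ (q + k * n)} ∪
            {x | ∃ k : ℤ, x = pα ε ^ (-p + k * m) * pβ ε ^ (-q + k * n)})) ∧
    (ε = -1 → ∀ m n : ℤ, u = pα ε ^ m * pβ ε ^ (2 * n) →
      (∀ p q : ℤ,
        Orb (Ghat ε u) (pα ε ^ p * pβ ε ^ (2 * q)) =
            {x | ∃ k : ℤ, x = u ^ k * (pα ε ^ p * pβ ε ^ (2 * q)) ∨
              x = u ^ k * (pα ε ^ p * pβ ε ^ (2 * q))⁻¹} ∧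
          Orb (Ghat ε u) (pα ε ^ p * pβ ε ^ (2 * q)) =
            {x | ∃ k : ℤ, x = pα ε ^ (p + k * m) * pβ ε ^ (2 * q + 2 * k * n)} ∪
              {x | ∃ k : ℤ, x = pα ε ^ (-p + k * m) * pβ ε ^ (-(2 * q) + 2 * k * n)}) ∧
      (∀ p q : ℤ,
        Orb (Ghat ε u) (pα ε ^ p * pβ ε ^ (2 * q + 1)) =
            {x | ∃ k r : ℤ, x = pα ε ^ (k * m) * pβ ε ^ ((2 * k + 4 * r) * n) *
                (pα ε ^ p * pβ ε ^ (2 * q + 1)) ∨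
              x = pα ε ^ (k * m) * pβ ε ^ ((2 * k + 4 * r) * n) *
                (pα ε ^ p * pβ ε ^ (2 * q + 1))⁻¹} ∧
          Orb (Ghat ε u) (pα ε ^ p * pβ ε ^ (2 * q + 1)) =
            {x | ∃ k r : ℤ,
                x = pα ε ^ (p + k * m) * pβ ε ^ (2 * q + 1 + (2 * k + 4 * r) * n)} ∪
              {x | ∃ k r : ℤ,
                x = pα ε ^ (p + k * m) * pβ ε ^ (-(2 * q + 1) + (2 * k + 4 * r) * n)}) ∧
      Nonempty ({O : Set (piQ ε) // ∃ h, w h = -1 ∧ O = Orb (Ghat ε u) h} ≃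
        (ZMod m.natAbs × ZMod n.natAbs)) ∧
      (m * n ≠ 0 → Nat.card {O : Set (piQ ε) // ∃ h, w h = -1 ∧ O = Orb (Ghat ε u) h} =
        (m * n).natAbs) ∧
      (m * n = 0 → Infinite {O : Set (piQ ε) // ∃ h, w h = -1 ∧ O = Orb (Ghat ε u) h})) := by
  refine ⟨?_, ?_⟩
  · rintro rfl m n p q hmn
    exact Orb_eq_union_of_commute commute_pα_pβ hmn p q
  · rintro rfl m n hmn
    have hab := pβ_mul_pα_neg_one
    refine ⟨fun p q => ?_, fun p q => ?_, nonempty_oddOrbits_equiv hwα hwβ hmn,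
      card_oddOrbits hwα hwβ hmn, infinite_oddOrbits hwα hwβ hmn⟩
    · have hmn' := hmn
      rw [zpow_mul] at hmn'
      have key := Orb_eq_union_of_commute (commute_sq_of_mul_eq hab) hmn' p q
      simp only [← zpow_mul, mul_add, mul_neg, ← mul_assoc (2 : ℤ)] at key
      exact key
    · refine ⟨?_, Orb_eq_of_odd hab hmn p q⟩
      have htrans (k r p s : ℤ) :
          pα (-1) ^ (k * m) * pβ (-1) ^ ((2 * k + 4 * r) * n) * (pα (-1) ^ p * pβ (-1) ^ s) =
            pα (-1) ^ (p + k * m) * pβ (-1) ^ (s + (2 * k + 4 * r) * n) := by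
        rw [show (2 * k + 4 * r) * n = 2 * ((k + 2 * r) * n) by ring,
          zpow_mul_zpow_even_mul hab, add_comm p, add_comm s]
      rw [Orb_eq_of_odd hab hmn]
      ext x
      simp only [inv_zpow_mul_zpow_odd hab, htrans, Set.mem_union, Set.mem_ofPred_eq, exists_or]

end Stmt17
end

section
/- An element g ∈ π₋ is G̃-singular if and only if either w₋(g) = 1 and g = β̄^{nk} for some k ∈ ℤ (with nk even), or w₋(g) = −1 and g = β̄^{nk}·ᾱ^{m} for some k, m ∈ ℤ (with nk odd). Moreover, the stabilizer of a G̃-singular element g = β̄^{nk}·ᾱ^{m} under the action of G̃ is the cyclic subgroup of G̃ generated by t^{k}·i; this element t^{k}·i is conjugate in G̃ to i if k is even and to t·i if k is odd. (Lemma 6.6.) -/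
namespace Stmt18

/-- The free group of rank 2, `F₂ = ⟨α, β⟩`. -/
abbrev F2 : Type := FreeGroup (Fin 2)

/-- The generator `α`. -/
def fα : F2 := FreeGroup.of 0

/-- The generator `β`. -/
def fβ : F2 := FreeGroup.of 1

/-- The Klein bottle relator `B = αβαβ⁻¹`. -/
def B : F2 := fα * fβ * fα * fβ⁻¹

/-- The Klein bottle group `π₋ = F₂/⟪αβαβ⁻¹⟫`. -/
abbrev K := F2 ⧸ Subgroup.normalClosure {B}

/-- The image `ᾱ` of `α` in `π₋`. -/
def pα : K := QuotientGroup.mk fα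

/-- The image `β̄` of `β` in `π₋`. -/
def pβ : K := QuotientGroup.mk fβ

/-- The relations `i²` and `(i·t)²` of the infinite dihedral group `G̃ = ⟨t, i ∣ i², (it)²⟩`,
with `t` the generator `0` and `i` the generator `1`. -/
def rels : Set (FreeGroup (Fin 2)) :=
  {(FreeGroup.of 1) ^ 2, (FreeGroup.of 1 * FreeGroup.of 0) ^ 2}

/-- The infinite dihedral group `G̃ = ⟨t, i ∣ i², (it)²⟩`. -/
abbrev Gt := PresentedGroup rels

/-- The generator `t` of `G̃`. -/
def t : Gt := PresentedGroup.of 0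

/-- The generator `i` of `G̃`. -/
def i : Gt := PresentedGroup.of 1

section InvertingConjugation

variable {G : Type*} [Group G] {a b : G}

theorem zpow_mul_of_conj_eq_inv (h : b * a = a⁻¹ * b) (m : ℤ) : a ^ m * b = b * a ^ (-m) := by
  have h1 : SemiconjBy b a a⁻¹ := h
  have h2 := (h1.zpow_right (-m)).eq
  rw [h2, inv_zpow, zpow_neg, inv_inv]

theorem zpow_mul_zpow_of_even (h : b * a = a⁻¹ * b) (m : ℤ) {k : ℤ} (hk : Even k) :
    a ^ m * b ^ k = b ^ k * a ^ m := by
  obtain ⟨j, rfl⟩ := hk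
  have hc : Commute (a ^ m) (b * b) := by
    change a ^ m * (b * b) = b * b * a ^ m
    rw [← mul_assoc, zpow_mul_of_conj_eq_inv h, mul_assoc, zpow_mul_of_conj_eq_inv h, neg_neg,
      mul_assoc]
  have h2 := (hc.zpow_right j).eq
  rwa [(Commute.refl b).mul_zpow, ← zpow_add] at h2

theorem zpow_mul_zpow_of_odd (h : b * a = a⁻¹ * b) (m : ℤ) {k : ℤ} (hk : Odd k) :
    a ^ m * b ^ k = b ^ k * a ^ (-m) := by
  obtain ⟨j, rfl⟩ := hk
  rw [zpow_add, zpow_one, ← mul_assoc, zpow_mul_zpow_of_even h m (even_two_mul j), mul_assoc,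
    zpow_mul_of_conj_eq_inv h, mul_assoc]

end InvertingConjugation

section KleinBottleGroup

theorem pβ_mul_pα : pβ * pα = pα⁻¹ * pβ := by
  have h : pα * pβ * pα * pβ⁻¹ = 1 :=
    (QuotientGroup.eq_one_iff B).2 (Subgroup.subset_normalClosure rfl)
  rw [eq_inv_mul_iff_mul_eq, ← mul_assoc]
  exact mul_inv_eq_one.1 h

theorem exists_eq_zpow_mul_zpow (g : K) : ∃ b a : ℤ, g = pβ ^ b * pα ^ a := by
  induction g using QuotientGroup.induction_on with
  | H z =>
    induction z using FreeGroup.induction_on with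
    | C1 => exact ⟨0, 0, by simp⟩
    | of x =>
      fin_cases x
      · exact ⟨0, 1, by simp [pα, fα]⟩
      · exact ⟨1, 0, by simp [pβ, fβ]⟩
    | inv_of x _ =>
      fin_cases x
      · exact ⟨0, -1, by simp [pα, fα]⟩
      · exact ⟨-1, 0, by simp [pβ, fβ]⟩
    | mul x y hx hy =>
      obtain ⟨b, a, hx⟩ := hx
      obtain ⟨d, c, hy⟩ := hy
      rw [QuotientGroup.mk_mul, hx, hy]
      rcases Int.even_or_odd d with hd | hd
      · refine ⟨b + d, a + c, ?_⟩
        rw [mul_assoc, ← mul_assoc (pα ^ a), zpow_mul_zpow_of_even pβ_mul_pα a hd, zpow_add,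
          zpow_add]
        group
      · refine ⟨b + d, -a + c, ?_⟩
        rw [mul_assoc, ← mul_assoc (pα ^ a), zpow_mul_zpow_of_odd pβ_mul_pα a hd, zpow_add,
          zpow_add]
        group

/-- A homomorphism out of `π₋` given by images of the generators satisfying the relation. -/
def liftK {G : Type*} [Group G] (x y : G) (h : x * y * x * y⁻¹ = 1) : K →* G :=
  QuotientGroup.lift (Subgroup.normalClosure {B}) (FreeGroup.lift ![x, y])
    (fun _ hz => Subgroup.normalClosure_le_normal (N := (FreeGroup.lift ![x, y]).ker)
      (by simpa [B, fα, fβ, MonoidHom.mem_ker] using h) hz)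

theorem liftK_pα {G : Type*} [Group G] (x y : G) (h : x * y * x * y⁻¹ = 1) :
    liftK x y h pα = x := by
  simp [liftK, pα, fα]

theorem liftK_pβ {G : Type*} [Group G] (x y : G) (h : x * y * x * y⁻¹ = 1) :
    liftK x y h pβ = y := by
  simp [liftK, pβ, fβ]

/-- The `β̄`-exponent of an element of `π₋`. -/
def expβ : K →* Multiplicative ℤ := liftK 1 (Multiplicative.ofAdd 1) (by simp)

/-- The action of `π₋` on `ℤ` in which `ᾱ` translates by one and `β̄` is negation. -/
def actionZ : K →* Equiv.Perm ℤ :=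
  liftK (Equiv.addRight 1) (Equiv.neg ℤ) (by ext x; simp [Equiv.Perm.mul_apply])

theorem expβ_zpow_mul_zpow (b a : ℤ) : expβ (pβ ^ b * pα ^ a) = Multiplicative.ofAdd b := by
  simp [expβ, liftK_pα, liftK_pβ, ← ofAdd_zsmul]

theorem pα_zpow_eq_one {a : ℤ} (h : pα ^ a = 1) : a = 0 := by
  have h1 := congrArg (fun g => actionZ g 0) h
  simpa [actionZ, liftK_pα] using h1

theorem zpow_mul_zpow_inj {b a d c : ℤ} :
    pβ ^ b * pα ^ a = pβ ^ d * pα ^ c ↔ b = d ∧ a = c := by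
  refine ⟨fun h => ?_, by rintro ⟨rfl, rfl⟩; rfl⟩
  have h1 := congrArg expβ h
  rw [expβ_zpow_mul_zpow, expβ_zpow_mul_zpow] at h1
  obtain rfl : b = d := Multiplicative.ofAdd.injective h1
  refine ⟨rfl, sub_eq_zero.1 (pα_zpow_eq_one ?_)⟩
  rw [zpow_sub, mul_left_cancel h, mul_inv_cancel]

theorem pβ_zpow_inj {b d : ℤ} : pβ ^ b = pβ ^ d ↔ b = d := by
  simpa using zpow_mul_zpow_inj (b := b) (a := 0) (d := d) (c := 0)

theorem sq_eq_pβ_zpow_iff (b a l : ℤ) :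
    (pβ ^ b * pα ^ a) * (pβ ^ b * pα ^ a) = pβ ^ (2 * l) ↔ b = l ∧ (Even b → a = 0) := by
  have hβ : pβ ^ (2 * l) = pβ ^ (2 * l) * pα ^ (0 : ℤ) := by simp
  rw [hβ, mul_assoc, ← mul_assoc (pα ^ a)]
  rcases Int.even_or_odd b with hb | hb
  · rw [zpow_mul_zpow_of_even pβ_mul_pα a hb, mul_assoc, ← zpow_add, ← mul_assoc, ← zpow_add,
      zpow_mul_zpow_inj]
    simp only [hb, true_imp_iff]
    omega
  · rw [zpow_mul_zpow_of_odd pβ_mul_pα a hb, mul_assoc, ← zpow_add, ← mul_assoc, ← zpow_add,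
      zpow_mul_zpow_inj]
    simp only [Int.not_even_iff_odd.2 hb, false_imp_iff, and_true]
    omega

theorem orientation_eq {w : K →* ℤˣ} (hwα : w pα = 1) (hwβ : w pβ = -1) (b a : ℤ) :
    w (pβ ^ b * pα ^ a) = if Even b then 1 else -1 := by
  rw [map_mul, map_zpow, map_zpow, hwα, hwβ, one_zpow, mul_one]
  split_ifs with hb
  · exact hb.neg_one_zpow
  · exact (Int.not_even_iff_odd.1 hb).neg_one_zpow

end KleinBottleGroup

section InfiniteDihedralGroup

theorem i_mul_i : i * i = 1 := by
  have h := PresentedGroup.one_of_mem (rels := rels) (x := FreeGroup.of 1 ^ 2) (by simp [rels])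
  rw [map_pow, pow_two] at h
  exact h

theorem i_mul_t : i * t = t⁻¹ * i := by
  have h := PresentedGroup.one_of_mem (rels := rels)
    (x := (FreeGroup.of 1 * FreeGroup.of 0) ^ 2) (by simp [rels])
  rw [map_pow, map_mul, pow_two] at h
  have h' : i * t * (i * t) = 1 := h
  rw [eq_inv_of_mul_eq_one_left h', mul_inv_rev, inv_eq_of_mul_eq_one_left i_mul_i]

theorem i_mul_t_zpow (k : ℤ) : i * t ^ k = t ^ (-k) * i := by
  rw [zpow_mul_of_conj_eq_inv i_mul_t, neg_neg]

theorem eq_zpow_or_eq_zpow_mul_i (r : Gt) : ∃ k : ℤ, r = t ^ k ∨ r = t ^ k * i := by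
  induction r using PresentedGroup.induction_on with
  | _ z =>
    have hi : i⁻¹ = i := inv_eq_of_mul_eq_one_left i_mul_i
    induction z using FreeGroup.induction_on with
    | C1 => exact ⟨0, Or.inl (by rw [map_one, zpow_zero])⟩
    | of x =>
      fin_cases x
      · exact ⟨1, Or.inl (by rw [zpow_one]; rfl)⟩
      · exact ⟨0, Or.inr (by rw [zpow_zero, one_mul]; rfl)⟩
    | inv_of x _ =>
      fin_cases x
      · exact ⟨-1, Or.inl (by rw [zpow_neg_one]; rfl)⟩
      · exact ⟨0, Or.inr (by rw [zpow_zero, one_mul, ← hi]; rfl)⟩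
    | mul x y hx hy =>
      obtain ⟨k, hx⟩ := hx
      obtain ⟨l, hy⟩ := hy
      rw [map_mul]
      rcases hx with hx | hx <;> rcases hy with hy | hy <;> rw [hx, hy]
      · exact ⟨k + l, Or.inl (zpow_add t k l).symm⟩
      · exact ⟨k + l, Or.inr (by rw [zpow_add, mul_assoc])⟩
      · exact ⟨k - l, Or.inr (by rw [mul_assoc, i_mul_t_zpow, ← mul_assoc, ← zpow_add,
          sub_eq_add_neg])⟩
      · exact ⟨k - l, Or.inl (by rw [mul_assoc, ← mul_assoc i, i_mul_t_zpow, mul_assoc, i_mul_i,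
          mul_one, ← zpow_add, sub_eq_add_neg])⟩

theorem isConj_zpow_mul_i (j k : ℤ) : IsConj (t ^ (2 * j + k) * i) (t ^ k * i) := by
  refine IsConj.symm (isConj_iff.2 ⟨t ^ j, ?_⟩)
  rw [← zpow_neg, mul_assoc, mul_assoc, i_mul_t_zpow, ← mul_assoc, ← mul_assoc, ← zpow_add,
    ← zpow_add, neg_neg]
  congr 2
  ring

theorem mem_zpowers_zpow_mul_i (k : ℤ) (r : Gt) :
    r ∈ Subgroup.zpowers (t ^ k * i) ↔ r = 1 ∨ r = t ^ k * i := by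
  have hs : (t ^ k * i) * (t ^ k * i) = 1 := by
    rw [mul_assoc, ← mul_assoc i, i_mul_t_zpow, mul_assoc, i_mul_i, mul_one, ← zpow_add,
      add_neg_cancel, zpow_zero]
  constructor
  · rintro ⟨m, rfl⟩
    change (t ^ k * i) ^ m = 1 ∨ (t ^ k * i) ^ m = t ^ k * i
    obtain ⟨j, rfl | rfl⟩ := Int.even_or_odd' m
    · left
      rw [zpow_mul, zpow_two, hs, one_zpow]
    · right
      rw [zpow_add, zpow_mul, zpow_two, hs, one_zpow, one_mul, zpow_one]
  · rintro (rfl | rfl)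
    · exact one_mem _
    · exact Subgroup.mem_zpowers _

end InfiniteDihedralGroup

section Action

variable {n : ℤ} {φ : Gt →* Equiv.Perm K}

theorem action_t_zpow (hφt : φ t = Equiv.mulLeft (pβ ^ (2 * n))) (k : ℤ) (g : K) :
    φ (t ^ k) g = pβ ^ (2 * (n * k)) * g := by
  rw [map_zpow, hφt, Equiv.zpow_mulLeft, ← zpow_mul, Equiv.coe_mulLeft, mul_assoc]

theorem action_t_zpow_eq_self_iff (hn : n ≠ 0) (hφt : φ t = Equiv.mulLeft (pβ ^ (2 * n)))
    (k : ℤ) (g : K) : φ (t ^ k) g = g ↔ k = 0 := by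
  rw [action_t_zpow hφt, mul_eq_right, ← zpow_zero pβ, pβ_zpow_inj]
  simp [hn]

theorem action_t_zpow_mul_i_eq_self_iff (hφt : φ t = Equiv.mulLeft (pβ ^ (2 * n)))
    (hφi : φ i = Equiv.inv K) (k b a : ℤ) :
    φ (t ^ k * i) (pβ ^ b * pα ^ a) = pβ ^ b * pα ^ a ↔ b = n * k ∧ (Even b → a = 0) := by
  rw [map_mul φ, Equiv.Perm.mul_apply, hφi, Equiv.inv_apply, action_t_zpow hφt,
    mul_inv_eq_iff_eq_mul, eq_comm, sq_eq_pβ_zpow_iff]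

theorem zpow_mul_i_ne_one (hφt : φ t = Equiv.mulLeft (pβ ^ (2 * n)))
    (hφi : φ i = Equiv.inv K) (k : ℤ) : t ^ k * i ≠ 1 := by
  intro h
  have h1 := action_t_zpow_mul_i_eq_self_iff hφt hφi k 0 1
  simp [h] at h1

theorem exists_ne_one_action_eq_self_iff (hn : n ≠ 0)
    (hφt : φ t = Equiv.mulLeft (pβ ^ (2 * n))) (hφi : φ i = Equiv.inv K) (b a : ℤ) :
    (∃ r : Gt, r ≠ 1 ∧ φ r (pβ ^ b * pα ^ a) = pβ ^ b * pα ^ a) ↔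
      n ∣ b ∧ (Even b → a = 0) := by
  constructor
  · rintro ⟨r, hr, h⟩
    obtain ⟨k, rfl | rfl⟩ := eq_zpow_or_eq_zpow_mul_i r
    · rw [action_t_zpow_eq_self_iff hn hφt] at h
      simp [h] at hr
    · rw [action_t_zpow_mul_i_eq_self_iff hφt hφi] at h
      exact ⟨⟨k, h.1⟩, h.2⟩
  · rintro ⟨⟨k, hk⟩, h⟩
    exact ⟨t ^ k * i, zpow_mul_i_ne_one hφt hφi k,
      (action_t_zpow_mul_i_eq_self_iff hφt hφi k b a).2 ⟨hk, h⟩⟩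

end Action

/-- **Lemma 6.6.**
Let `n ≠ 0`, and let `G̃ = ⟨t, i ∣ i², (it)²⟩` act on `π₋` via `t·g = β̄^{2n}·g` and
`i·g = g⁻¹` (the action being encoded by a homomorphism `φ : G̃ → Perm π₋` with
`φ t = (β̄^{2n}·)` and `φ i = (·⁻¹)`).  An element `g ∈ π₋` is `G̃`-singular (i.e. has
nontrivial stabilizer) if and only if either `w₋(g) = 1` and `g = β̄^{nk}` for some
`k ∈ ℤ`, or `w₋(g) = -1` and `g = β̄^{nk}·ᾱ^m` for some `k, m ∈ ℤ`.  Moreover the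
stabilizer of a `G̃`-singular element `g = β̄^{nk}·ᾱ^m` is the cyclic subgroup of `G̃`
generated by `t^k·i`, and `t^k·i` is conjugate in `G̃` to `i` if `k` is even and to
`t·i` if `k` is odd. -/
theorem statement (n : ℤ) (hn : n ≠ 0) (w : K →* ℤˣ)
    (hwα : w pα = 1) (hwβ : w pβ = -1)
    (φ : Gt →* Equiv.Perm K)
    (hφt : φ t = Equiv.mulLeft (pβ ^ (2 * n))) (hφi : φ i = Equiv.inv K)
    (g : K) :
    ((∃ rr : Gt, rr ≠ 1 ∧ φ rr g = g) ↔
      ((∃ k : ℤ, w g = 1 ∧ g = pβ ^ (n * k)) ∨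
        (∃ k m : ℤ, w g = -1 ∧ g = pβ ^ (n * k) * pα ^ m))) ∧
    (∀ k m : ℤ, g = pβ ^ (n * k) * pα ^ m → (∃ rr : Gt, rr ≠ 1 ∧ φ rr g = g) →
      ((∀ rr : Gt, φ rr g = g ↔ rr ∈ Subgroup.zpowers (t ^ k * i)) ∧
        (Even k → IsConj (t ^ k * i) i) ∧
        (Odd k → IsConj (t ^ k * i) (t * i)))) := by
  constructor
  · obtain ⟨b, a, rfl⟩ := exists_eq_zpow_mul_zpow g
    rw [exists_ne_one_action_eq_self_iff hn hφt hφi, orientation_eq hwα hwβ]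
    simp only [zpow_mul_zpow_inj]
    have hα : ∀ k : ℤ, pβ ^ b * pα ^ a = pβ ^ (n * k) ↔ b = n * k ∧ a = 0 := fun k => by
      simpa using zpow_mul_zpow_inj (b := b) (a := a) (d := n * k) (c := 0)
    simp only [hα]
    by_cases hb : Even b
    · simp [hb, dvd_def]
    · simp [hb, dvd_def]
  · rintro k m rfl hs
    rw [exists_ne_one_action_eq_self_iff hn hφt hφi] at hs
    refine ⟨fun r => ?_, ?_, ?_⟩
    · rw [mem_zpowers_zpow_mul_i]
      constructor
      · intro h
        obtain ⟨l, rfl | rfl⟩ := eq_zpow_or_eq_zpow_mul_i r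
        · rw [action_t_zpow_eq_self_iff hn hφt] at h
          exact Or.inl (by rw [h, zpow_zero])
        · rw [action_t_zpow_mul_i_eq_self_iff hφt hφi] at h
          exact Or.inr (by rw [mul_left_cancel₀ hn h.1])
      · rintro (rfl | rfl)
        · simp
        · exact (action_t_zpow_mul_i_eq_self_iff hφt hφi k _ m).2 ⟨rfl, hs.2⟩
    · intro hk
      obtain ⟨j, rfl⟩ := hk.two_dvd
      simpa using isConj_zpow_mul_i j 0
    · rintro ⟨j, rfl⟩
      simpa using isConj_zpow_mul_i j 1

end Stmt18
end

section
/- An element g ∈ π₋ is defective if and only if g = β̄^{nk}·ᾱ^{m} for some k, m ∈ ℤ. (Lemma 6.8.) -/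
namespace Stmt19

/-- The free group of rank 2, `F₂ = ⟨α, β⟩`. -/
abbrev F2 : Type := FreeGroup (Fin 2)

/-- The generator `α`. -/
def fα : F2 := FreeGroup.of 0

/-- The generator `β`. -/
def fβ : F2 := FreeGroup.of 1

/-- The Klein bottle relator `B = αβαβ⁻¹`. -/
def B : F2 := fα * fβ * fα * fβ⁻¹

/-- The Klein bottle group `π₋ = F₂/⟪αβαβ⁻¹⟫`. -/
abbrev K := F2 ⧸ Subgroup.normalClosure {B}

/-- The image `ᾱ` of `α` in `π₋`. -/
def pα : K := QuotientGroup.mk fα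

/-- The image `β̄` of `β` in `π₋`. -/
def pβ : K := QuotientGroup.mk fβ

/-- The relations `i²`, `j²`, `(ij)²`, `(it)²`, `(jt)²` of the group
`G̃_L = ⟨t, i, j ∣ i², j², (ij)², (it)², (jt)²⟩ ≅ ℤ ⋊ (ℤ₂ ⊕ ℤ₂)`, with `t` the
generator `0`, `i` the generator `1` and `j` the generator `2`. -/
def rels : Set (FreeGroup (Fin 3)) :=
  {(FreeGroup.of 1) ^ 2, (FreeGroup.of 2) ^ 2, (FreeGroup.of 1 * FreeGroup.of 2) ^ 2,
    (FreeGroup.of 1 * FreeGroup.of 0) ^ 2, (FreeGroup.of 2 * FreeGroup.of 0) ^ 2}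

/-- The group `G̃_L = ⟨t, i, j ∣ i², j², (ij)², (it)², (jt)²⟩ ≅ ℤ ⋊ (ℤ₂ ⊕ ℤ₂)`. -/
abbrev GtL := PresentedGroup rels

/-- The generator `t` of `G̃_L`. -/
def t : GtL := PresentedGroup.of 0

/-- The generator `i` of `G̃_L`. -/
def i : GtL := PresentedGroup.of 1

/-- The generator `j` of `G̃_L`. -/
def j : GtL := PresentedGroup.of 2

/-- The permutation `g ↦ ᾱ^L β̄^ℓ · (ᾱ^L β̄^ℓ · g)⁻¹ = (ᾱ^L β̄^ℓ) g⁻¹ (ᾱ^L β̄^ℓ)⁻¹`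
of `π₋`. -/
def Jperm (L ℓ : ℤ) : Equiv.Perm K :=
  (Equiv.inv K).trans (MulAut.conj (pα ^ L * pβ ^ ℓ)).toEquiv

/-- The Klein bottle relation `β̄ ᾱ β̄⁻¹ = ᾱ⁻¹`, as a semiconjugacy. -/
theorem semiconjBy_pβ : SemiconjBy pβ pα pα⁻¹ := by
  have h : pα * pβ * pα * pβ⁻¹ = 1 :=
    (QuotientGroup.eq_one_iff B).2 (Subgroup.subset_normalClosure rfl)
  rw [SemiconjBy, eq_inv_mul_iff_mul_eq, ← mul_inv_eq_one, ← mul_assoc]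
  exact h

theorem semiconjBy_pβ_zpow (m : ℤ) : SemiconjBy pβ (pα ^ m) (pα ^ (-m)) := by
  simpa only [inv_zpow'] using semiconjBy_pβ.zpow_right m

theorem commute_pβ_mul_self_zpow (m : ℤ) : Commute (pβ * pβ) (pα ^ m) := by
  have h := (semiconjBy_pβ_zpow (-m)).mul_left (semiconjBy_pβ_zpow m)
  rwa [neg_neg] at h

theorem commute_pβ_zpow_of_even {b : ℤ} (hb : Even b) (m : ℤ) :
    Commute (pβ ^ b) (pα ^ m) := by
  obtain ⟨c, rfl⟩ := hb
  have h := (commute_pβ_mul_self_zpow m).zpow_left c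
  rwa [(Commute.refl pβ).mul_zpow, ← zpow_add] at h

theorem semiconjBy_pβ_zpow_of_odd {b : ℤ} (hb : Odd b) (m : ℤ) :
    SemiconjBy (pβ ^ b) (pα ^ m) (pα ^ (-m)) := by
  obtain ⟨c, rfl⟩ := hb
  rw [zpow_add, zpow_one]
  exact SemiconjBy.mul_left (commute_pβ_zpow_of_even (even_two_mul c) (-m)) (semiconjBy_pβ_zpow m)

theorem exists_pα_zpow_mul_pβ_zpow (m b : ℤ) :
    ∃ m' : ℤ, pα ^ m * pβ ^ b = pβ ^ b * pα ^ m' := by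
  rcases Int.even_or_odd b with hb | hb
  · exact ⟨m, (commute_pβ_zpow_of_even hb m).eq.symm⟩
  · refine ⟨-m, ?_⟩
    simpa only [neg_neg] using (semiconjBy_pβ_zpow_of_odd hb (-m)).eq.symm

/-- Every element of `π₋` has a normal form `β̄^b ᾱ^m`. -/
theorem exists_normal_form (g : K) : ∃ b m : ℤ, g = pβ ^ b * pα ^ m := by
  have hinv : ∀ b m : ℤ, ∃ b' m' : ℤ, (pβ ^ b * pα ^ m)⁻¹ = pβ ^ b' * pα ^ m' := by
    intro b m
    obtain ⟨m', h⟩ := exists_pα_zpow_mul_pβ_zpow (-m) (-b)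
    exact ⟨-b, m', by rw [mul_inv_rev, ← zpow_neg, ← zpow_neg, h]⟩
  have hof : ∀ x : Fin 2, ∃ b m : ℤ, (QuotientGroup.mk (FreeGroup.of x) : K) = pβ ^ b * pα ^ m := by
    intro x
    fin_cases x
    · exact ⟨0, 1, by rw [zpow_zero, one_mul, zpow_one]; rfl⟩
    · exact ⟨1, 0, by rw [zpow_zero, mul_one, zpow_one]; rfl⟩
  induction g using QuotientGroup.induction_on with
  | H z =>
    induction z using FreeGroup.induction_on with
    | C1 => exact ⟨0, 0, by rw [zpow_zero, zpow_zero, mul_one]; rfl⟩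
    | of x => exact hof x
    | inv_of x _ =>
      obtain ⟨b, m, h⟩ := hof x
      rw [QuotientGroup.mk_inv, h]
      exact hinv b m
    | mul x y hx hy =>
      obtain ⟨b, m, h⟩ := hx
      obtain ⟨c, d, h'⟩ := hy
      obtain ⟨m', h''⟩ := exists_pα_zpow_mul_pβ_zpow m c
      refine ⟨b + c, m' + d, ?_⟩
      rw [QuotientGroup.mk_mul, h, h', mul_assoc, ← mul_assoc (pα ^ m), h'', zpow_add, zpow_add]
      simp only [mul_assoc]

/-- The exponent sum of `β`, as a homomorphism on `π₋`. -/
def βexp : K →* Multiplicative ℤ :=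
  QuotientGroup.lift _ (FreeGroup.lift ![1, Multiplicative.ofAdd 1]) <|
    Subgroup.normalClosure_le_normal (Set.singleton_subset_iff.2 (by
      simp [B, fα, fβ]))

theorem βexp_pα : βexp pα = 1 := by
  simp [βexp, pα, fα]

theorem βexp_pβ : βexp pβ = Multiplicative.ofAdd 1 := by
  simp [βexp, pβ, fβ]

theorem βexp_normal_form (b m : ℤ) : (βexp (pβ ^ b * pα ^ m)).toAdd = b := by
  simp [βexp_pα, βexp_pβ]

/-- **Lemma 6.8.**
Let `n ≠ 0`, `ℓ` the greatest odd divisor of `|n|`, `L ∈ ℤ`, and let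
`G̃_L = ⟨t, i, j ∣ i², j², (ij)², (it)², (jt)²⟩` act on `π₋` via `t·g = β̄^{2n}·g`,
`i·g = g⁻¹`, `j·g = ᾱ^L β̄^ℓ (ᾱ^L β̄^ℓ g)⁻¹` (the action encoded by a homomorphism
`φ : G̃_L → Perm π₋` with the indicated values on `t`, `i`, `j`), and let
`χ_L : G̃_L → {±1}` be the character with `χ_L(t) = 1`, `χ_L(i) = χ_L(j) = -1`.
An element `g ∈ π₋` is defective (i.e. there is `r ∈ G̃_L` with `r·g = g` and
`χ_L(r) = -1`) if and only if `g = β̄^{nk}·ᾱ^m` for some `k, m ∈ ℤ`. -/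
theorem statement (n : ℤ) (hn : n ≠ 0) (L ℓ : ℤ)
    (hℓ : Odd ℓ ∧ 0 < ℓ ∧ ℓ ∣ n ∧ ∀ ℓ' : ℤ, Odd ℓ' → ℓ' ∣ n → ℓ' ≤ ℓ)
    (φ : GtL →* Equiv.Perm K)
    (hφt : φ t = Equiv.mulLeft (pβ ^ (2 * n))) (hφi : φ i = Equiv.inv K)
    (hφj : φ j = Jperm L ℓ)
    (χ : GtL →* ℤˣ) (hχt : χ t = 1) (hχi : χ i = -1) (hχj : χ j = -1)
    (g : K) :
    (∃ rr : GtL, φ rr g = g ∧ χ rr = -1) ↔ ∃ k m : ℤ, g = pβ ^ (n * k) * pα ^ m := by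
  obtain ⟨hodd, -⟩ := hℓ
  constructor
  · have key : ∀ r : GtL, ∃ k : ℤ, ∀ x : K,
        (βexp (φ r x)).toAdd = 2 * n * k + (χ r : ℤ) * (βexp x).toAdd := by
      intro r
      have hr : r ∈ Subgroup.closure (Set.range (PresentedGroup.of (rels := rels))) := by
        rw [PresentedGroup.closure_range_of]; trivial
      induction hr using Subgroup.closure_induction with
      | mem r hr =>
        obtain ⟨c, rfl⟩ := hr
        fin_cases c
        · refine ⟨1, fun x => ?_⟩
          change (βexp (φ t x)).toAdd = 2 * n * 1 + (χ t : ℤ) * (βexp x).toAdd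
          simp [hφt, hχt, βexp_pβ]
        · refine ⟨0, fun x => ?_⟩
          change (βexp (φ i x)).toAdd = 2 * n * 0 + (χ i : ℤ) * (βexp x).toAdd
          simp [hφi, hχi]
        · refine ⟨0, fun x => ?_⟩
          change (βexp (φ j x)).toAdd = 2 * n * 0 + (χ j : ℤ) * (βexp x).toAdd
          rw [hφj, hχj]
          change (βexp (pα ^ L * pβ ^ ℓ * x⁻¹ * (pα ^ L * pβ ^ ℓ)⁻¹)).toAdd = _
          rw [map_mul βexp, map_mul βexp, map_inv βexp, map_inv βexp, mul_inv_cancel_comm]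
          simp
      | one => exact ⟨0, fun x => by simp⟩
      | mul r s _ _ hr hs =>
        obtain ⟨k, hk⟩ := hr
        obtain ⟨k', hk'⟩ := hs
        refine ⟨k + (χ r : ℤ) * k', fun x => ?_⟩
        rw [map_mul, map_mul, Equiv.Perm.mul_apply, hk, hk', Units.val_mul]
        ring
      | inv r _ hr =>
        obtain ⟨k, hk⟩ := hr
        refine ⟨-(χ r : ℤ) * k, fun x => ?_⟩
        have h := hk (φ r⁻¹ x)
        rw [map_inv, ← Equiv.Perm.mul_apply, mul_inv_cancel, Equiv.Perm.one_apply] at h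
        rw [map_inv, map_inv, h, Int.units_inv_eq_self]
        have hsq : (χ r : ℤ) * χ r = 1 := by
          rw [← Units.val_mul, Int.units_mul_self, Units.val_one]
        linear_combination (-(βexp ((φ r)⁻¹ x)).toAdd) * hsq
    rintro ⟨r, hr, hχ⟩
    obtain ⟨k, hk⟩ := key r
    obtain ⟨b, m, rfl⟩ := exists_normal_form g
    have h := hk (pβ ^ b * pα ^ m)
    rw [hr, hχ, βexp_normal_form, Units.val_neg, Units.val_one] at h
    exact ⟨k, m, by rw [show b = n * k by linarith]⟩
  · rintro ⟨k, m, rfl⟩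
    have ht : φ (t ^ k) = Equiv.mulLeft (pβ ^ (n * k + n * k)) := by
      rw [map_zpow, hφt, Equiv.zpow_mulLeft, ← zpow_mul]
      congr 2
      ring
    rcases Int.even_or_odd (n * k) with hb | hb
    · refine ⟨t ^ k * j, ?_, by simp [hχt, hχj]⟩
      generalize n * k = b at *
      rw [map_mul φ, Equiv.Perm.mul_apply, ht, hφj]
      change pβ ^ (b + b) * (pα ^ L * pβ ^ ℓ * (pβ ^ b * pα ^ m)⁻¹ * (pα ^ L * pβ ^ ℓ)⁻¹) = _
      have hw : SemiconjBy (pα ^ L * pβ ^ ℓ) (pα ^ (-m)) (pα ^ m) := by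
        refine SemiconjBy.mul_left (Commute.zpow_zpow_self pα L m) ?_
        simpa only [neg_neg] using semiconjBy_pβ_zpow_of_odd hodd (-m)
      have hc : Commute (pα ^ L * pβ ^ ℓ) (pβ ^ (-b)) :=
        Commute.mul_left (commute_pβ_zpow_of_even hb.neg L).symm (Commute.zpow_zpow_self pβ ℓ (-b))
      rw [mul_inv_rev, ← zpow_neg, ← zpow_neg, (SemiconjBy.mul_right hw hc).eq, mul_inv_cancel_right,
        (commute_pβ_zpow_of_even hb.neg m).symm.eq, ← mul_assoc, ← zpow_add, add_neg_cancel_right]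
    · refine ⟨t ^ k * i, ?_, by simp [hχt, hχi]⟩
      generalize n * k = b at *
      rw [map_mul φ, Equiv.Perm.mul_apply, ht, hφi]
      change pβ ^ (b + b) * (pβ ^ b * pα ^ m)⁻¹ = _
      rw [mul_inv_rev, ← zpow_neg, ← zpow_neg, ← (semiconjBy_pβ_zpow_of_odd hb.neg m).eq,
        ← mul_assoc, ← zpow_add, add_neg_cancel_right]

end Stmt19
end
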